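/- arXiv:2105.08373 — 2 statements merged into one kernel-verified Lean document; each statement's English description precedes it below -/
import Mathlib

section
/- Let (𝒳₀,𝒳₁) and (𝒴₀,𝒴₁) be compatible couples of sequentially structured Banach spaces with 𝔖₀ and 𝔖₁ both ℓ∞-sequence structures, and let X̆ be a dense subspace of X₀ ∩ X₁. Let {T(z)}_{z∈S̄} be a family of linear operators from X̆ to Y₀+Y₁ such that: (a) for every x ∈ X̆ the map z ↦ T(z)x belongs to ℋ_π(S̄;Y₀+Y₁); (b) for j = 0,1 there are constants M_j > 0 such that for every finitely nonzero sequence x⃗ with entries in X̆ one has ‖ℱ( t ↦ Σ_{k∈ℤ} e^{ikt} T(j+it) x_k )‖_{𝔗_j} ≤ M_j ‖x⃗‖_{𝔖_j}, where ℱ g denotes the sequence of Fourier coefficients (ĝ(k))_{k∈ℤ} of the 2π-periodic function g. Then for every θ ∈ (0,1): T(θ)X̆ ⊆ (𝒴₀,𝒴₁)_θ and ‖T(θ)x‖_{(𝒴₀,𝒴₁)_θ} ≲_θ M₀^{1−θ} M₁^{θ} ‖x‖_{(𝒳₀,𝒳₁)_θ} for all x ∈ X̆, with a constant depending only on θ.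 In particular, if 𝔖₀ or 𝔖₁ is a c₀-sequence structure, T(θ) extends to a bounded linear operator from (𝒳₀,𝒳₁)_θ to (𝒴₀,𝒴₁)_θ. -/
open scoped ENNReal NNReal
open Filter Topology

universe u v

/-- The axioms of a complete ("Banach") extended norm on a module over a normed field:
definiteness, the triangle inequality, homogeneity, and completeness of the finiteness
domain.  A Banach space continuously embedded into an ambient space `E` is encoded as such
an extended norm on `E`; the Banach space itself is the finiteness domain. -/
def IsBanachENorm (𝕜 : Type*) {E : Type*} [NormedField 𝕜] [AddCommGroup E] [Module 𝕜 E]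
    (N : E → ℝ≥0∞) : Prop :=
  (∀ x : E, N x = 0 → x = 0) ∧
  (∀ x y : E, N (x + y) ≤ N x + N y) ∧
  (∀ (c : 𝕜) (x : E), N (c • x) ≤ (‖c‖₊ : ℝ≥0∞) * N x) ∧
  (∀ f : ℕ → E, (∀ n, N (f n) ≠ ∞) →
    (∀ ε : ℝ≥0∞, 0 < ε → ∃ n₀ : ℕ, ∀ m, n₀ ≤ m → ∀ n, n₀ ≤ n → N (f m - f n) < ε) →
    ∃ x : E, N x ≠ ∞ ∧ Filter.Tendsto (fun n => N (f n - x)) Filter.atTop (nhds 0))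

/-- A Banach space continuously embedded into the ambient space `E`, encoded as a complete
extended norm on `E`. -/
structure BanachENorm (𝕜 : Type*) (E : Type*) [NormedField 𝕜] [AddCommGroup E]
    [Module 𝕜 E] where
  toFun : E → ℝ≥0∞
  isBanachENorm : IsBanachENorm 𝕜 toFun

/-- A sequence structure `𝔖` on the Banach space `X`: a Banach space of `X`-valued sequences
which is translation invariant, contains the single-entry sequences isometrically, and has
contractive coordinate projections. -/
structure SeqStructure (𝕜 : Type*) (E : Type*) [NormedField 𝕜] [AddCommGroup E] [Module 𝕜 E]
    (X : BanachENorm 𝕜 E) where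
  toFun : (ℤ → E) → ℝ≥0∞
  isBanachENorm : IsBanachENorm 𝕜 toFun
  single : ∀ (v : E) (n : ℤ), toFun (fun k => if k = n then v else 0) = X.toFun v
  shift : ∀ (x : ℤ → E) (n : ℤ), toFun (fun k => x (k + n)) = toFun x
  coord : ∀ (x : ℤ → E) (n : ℤ), X.toFun (x n) ≤ toFun x

/-- The `n`-th Cesàro mean `C_n x⃗ = (n+1)⁻¹ ∑_{m=0}^{n} x⃗⁽ᵐ⁾`, where `x⃗⁽ᵐ⁾` is the
truncation of `x⃗` to the indices `|k| ≤ m`. -/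
noncomputable def cesaro (𝕜 : Type*) {E : Type*} [NormedField 𝕜] [AddCommGroup E]
    [Module 𝕜 E] (n : ℕ) (x : ℤ → E) : ℤ → E :=
  fun k => (n + 1 : 𝕜)⁻¹ • ∑ m ∈ Finset.range (n + 1), (if |k| ≤ (m : ℤ) then x k else 0)

/-- An `ℓ∞`-sequence structure: the Cesàro operators are contractive. -/
def IsLinftySeqStructure {𝕜 E : Type*} [NormedField 𝕜] [AddCommGroup E] [Module 𝕜 E]
    {X : BanachENorm 𝕜 E} (S : SeqStructure 𝕜 E X) : Prop :=
  ∀ (n : ℕ) (x : ℤ → E), S.toFun (cesaro 𝕜 n x) ≤ S.toFun x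

/-- A `c₀`-sequence structure: the Cesàro operators are contractive and `C_n x⃗ → x⃗` in `𝔖`
for every `x⃗ ∈ 𝔖`. -/
def IsC0SeqStructure {𝕜 E : Type*} [NormedField 𝕜] [AddCommGroup E] [Module 𝕜 E]
    {X : BanachENorm 𝕜 E} (S : SeqStructure 𝕜 E X) : Prop :=
  IsLinftySeqStructure S ∧
    ∀ x : ℤ → E, S.toFun x ≠ ∞ →
      Filter.Tendsto (fun n => S.toFun (cesaro 𝕜 n x - x)) Filter.atTop (nhds 0)

/-- The extended norm of the sum of two extended-normed spaces. -/
noncomputable def enSum {V : Type*} [AddCommGroup V] (N M : V → ℝ≥0∞) : V → ℝ≥0∞ :=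
  fun v => ⨅ w : V, N w + M (v - w)

/-- The extended norm of the intersection of two extended-normed spaces. -/
def enInter {V : Type*} (N M : V → ℝ≥0∞) : V → ℝ≥0∞ := fun v => max (N v) (M v)

/-- The weighted sequence space `𝔖(a)`, `‖x⃗‖_{𝔖(a)} = ‖(a^k x_k)_k‖_𝔖`. -/
noncomputable def wtSeq {E : Type*} [AddCommGroup E] [Module ℝ E] (a : ℝ)
    (S : (ℤ → E) → ℝ≥0∞) : (ℤ → E) → ℝ≥0∞ :=
  fun x => S fun k => (a ^ k) • x k

/-- The sequentially structured interpolation extended norm with base number `b`: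
`‖v‖_{(𝒳₀,𝒳₁)_{θ;b}} = inf { max_{j=0,1} ‖(b^{k(j-θ)} x_k)_k‖_{𝔖_j} : ∑_k x_k = v }`,
the sum converging in the sum space `X₀ + X₁` (the ambient space `E`). -/
noncomputable def interpENormB {E : Type*} [NormedAddCommGroup E] [NormedSpace ℝ E] (b : ℝ)
    (S₀ S₁ : (ℤ → E) → ℝ≥0∞) (θ : ℝ) (v : E) : ℝ≥0∞ :=
  ⨅ (x : ℤ → E) (_ : HasSum x v),
    max (wtSeq (b ^ (-θ)) S₀ x) (wtSeq (b ^ (1 - θ)) S₁ x)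

/-- The sequentially structured interpolation extended norm (base number `e`). -/
noncomputable def interpENorm {E : Type*} [NormedAddCommGroup E] [NormedSpace ℝ E]
    (S₀ S₁ : (ℤ → E) → ℝ≥0∞) (θ : ℝ) (v : E) : ℝ≥0∞ :=
  ⨅ (x : ℤ → E) (_ : HasSum x v),
    max (wtSeq (Real.exp (-θ)) S₀ x) (wtSeq (Real.exp (1 - θ)) S₁ x)

/-- The mean-method formulation of the interpolation norm. -/
noncomputable def meanENorm {E : Type*} [AddCommGroup E] [Module ℝ E]
    (S₀ S₁ : (ℤ → E) → ℝ≥0∞) (θ : ℝ) (v : E) : ℝ≥0∞ :=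
  ⨅ (x0 : ℤ → E) (x1 : ℤ → E) (_ : ∀ k : ℤ, x0 k + x1 k = v),
    wtSeq (Real.exp (-θ)) S₀ x0 + wtSeq (Real.exp (1 - θ)) S₁ x1

/-- The dual extended norm on linear functionals. -/
noncomputable def dualENorm {E : Type*} [AddCommGroup E] [Module ℝ E] (N : E → ℝ≥0∞)
    (φ : E →ₗ[ℝ] ℝ) : ℝ≥0∞ :=
  ⨆ (x : E) (_ : N x ≤ 1), (‖φ x‖₊ : ℝ≥0∞)

/-- The dual sequence norm, via the pairing `⟨x⃗, x⃗*⟩ = ∑_k ⟨x_k, x*_k⟩`. -/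
noncomputable def dualSeqENorm {E : Type*} [AddCommGroup E] [Module ℝ E]
    (S : (ℤ → E) → ℝ≥0∞) (Φ : ℤ → E →ₗ[ℝ] ℝ) : ℝ≥0∞ :=
  ⨆ (x : ℤ → E) (_ : (Function.support x).Finite) (_ : S x ≤ 1),
    (‖∑ᶠ k : ℤ, Φ k (x k)‖₊ : ℝ≥0∞)

/-- The interpolation norm of the dual couple `(𝒳₀*,𝒳₁*)_θ`
(in its mean-method formulation). -/
noncomputable def dualInterpMean {E : Type*} [AddCommGroup E] [Module ℝ E]
    (S₀ S₁ : (ℤ → E) → ℝ≥0∞) (θ : ℝ) (φ : E →ₗ[ℝ] ℝ) : ℝ≥0∞ :=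
  ⨅ (Φ₀ : ℤ → E →ₗ[ℝ] ℝ) (Φ₁ : ℤ → E →ₗ[ℝ] ℝ) (_ : ∀ k : ℤ, Φ₀ k + Φ₁ k = φ),
    wtSeq (Real.exp (-θ)) (dualSeqENorm S₀) Φ₀ +
      wtSeq (Real.exp (1 - θ)) (dualSeqENorm S₁) Φ₁

/-- Membership in the closure, inside the space with extended norm `Nj`, of the space with
extended norm `N`. -/
def memClosIn {E : Type*} [AddCommGroup E] (Nj N : E → ℝ≥0∞) (w : E) : Prop :=
  Nj w ≠ ∞ ∧ ∀ ε : ℝ≥0∞, 0 < ε → ∃ u : E, N u ≠ ∞ ∧ Nj (w - u) < ε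

open Classical in
/-- The extended norm of the closure, inside the space with extended norm `Nj`, of the
space with extended norm `N`. -/
noncomputable def closENorm {E : Type*} [AddCommGroup E] (Nj N : E → ℝ≥0∞) : E → ℝ≥0∞ :=
  fun w => if memClosIn Nj N w then Nj w else ∞

/-- Membership in `𝔖^∘`, the closure in `𝔖` of the finitely nonzero sequences with entries
in the closure of the `N`-space inside the `Nj`-space. -/
def memSeqClos {E : Type*} [AddCommGroup E] (S : (ℤ → E) → ℝ≥0∞) (Nj N : E → ℝ≥0∞)
    (x : ℤ → E) : Prop :=
  S x ≠ ∞ ∧ ∀ ε : ℝ≥0∞, 0 < ε → ∃ y : ℤ → E,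
    (Function.support y).Finite ∧ (∀ k, memClosIn Nj N (y k)) ∧ S (x - y) < ε

open Classical in
/-- The extended norm of `𝔖^∘`. -/
noncomputable def seqClosENorm {E : Type*} [AddCommGroup E] (S : (ℤ → E) → ℝ≥0∞)
    (Nj N : E → ℝ≥0∞) : (ℤ → E) → ℝ≥0∞ :=
  fun x => if memSeqClos S Nj N x then S x else ∞

/-- The `(𝔖,𝔗)`-bound of an operator. -/
noncomputable def seqOpENorm {E F : Type*} [AddCommGroup E] [Module ℝ E]
    [AddCommGroup F] [Module ℝ F] (S : (ℤ → E) → ℝ≥0∞) (T : (ℤ → F) → ℝ≥0∞)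
    (A : E →ₗ[ℝ] F) : ℝ≥0∞ :=
  ⨆ (x : ℤ → E) (_ : S x ≤ 1), T fun k => A (x k)

/-- The open strip `𝕊 = {0 < Re z < 1}`. -/
def openStrip : Set ℂ := {z : ℂ | 0 < z.re ∧ z.re < 1}

/-- The closed strip `S̄ = {0 ≤ Re z ≤ 1}`. -/
def closedStrip : Set ℂ := {z : ℂ | 0 ≤ z.re ∧ z.re ≤ 1}

/-- The `k`-th Fourier coefficient of the `2π`-periodic function `t ↦ f (s + it)`. -/
noncomputable def fourierCoef {X : Type*} [NormedAddCommGroup X] [NormedSpace ℂ X]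
    (f : ℂ → X) (s : ℝ) (k : ℤ) : X :=
  (2 * (Real.pi : ℂ))⁻¹ • ∫ t in (-Real.pi)..Real.pi,
    Complex.exp (-(k : ℂ) * Complex.I * (t : ℂ)) • f ((s : ℂ) + (t : ℂ) * Complex.I)

/-- The lower complex formulation norm `‖·‖^{(c)}_{(𝒳₀,𝒳₁)_θ}`. -/
noncomputable def lowerCNorm {E : Type*} [NormedAddCommGroup E] [NormedSpace ℂ E]
    (S₀ S₁ : (ℤ → E) → ℝ≥0∞) (θ : ℝ) (v : E) : ℝ≥0∞ :=
  ⨅ (f : ℂ → E) (_ : ContinuousOn f closedStrip)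
    (_ : ∀ z ∈ openStrip, DifferentiableAt ℂ f z)
    (_ : ∀ z ∈ closedStrip, f (z + 2 * (Real.pi : ℂ) * Complex.I) = f z)
    (_ : f (θ : ℂ) = v),
    max (S₀ fun k => fourierCoef f 0 k) (S₁ fun k => fourierCoef f 1 k)


/-- Properties of a weighted sequence norm. -/
structure WS {E : Type*} [NormedAddCommGroup E] [NormedSpace ℂ E] (N : E → ℝ≥0∞) (a : ℝ)
    (P : (ℤ → E) → ℝ≥0∞) : Prop where
  apos : 0 < a
  norm_le : ∀ v, ‖v‖ₑ ≤ N v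
  Nadd : ∀ v w, N (v + w) ≤ N v + N w
  Nsmul : ∀ (c : ℂ) v, N (c • v) ≤ ‖c‖ₑ * N v
  add_le : ∀ x y, P (x + y) ≤ P x + P y
  smul_le : ∀ (c : ℂ) x, P (c • x) ≤ ‖c‖ₑ * P x
  single : ∀ v (n : ℤ), P (fun k => if k = n then v else 0) ≤ ENNReal.ofReal (a ^ n) * N v
  shift : ∀ x (n : ℤ), P (fun k => x (k + n)) ≤ ENNReal.ofReal (a ^ (-n)) * P x
  coord : ∀ x (k : ℤ), N (x k) ≤ ENNReal.ofReal (a ^ (-k)) * P x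
  tsum : ∀ (g : ℕ → ℤ → E) (s : ℤ → E), ∑' n, P (g n) ≠ ∞ →
    (∀ k, HasSum (fun n => g n k) (s k)) → P s ≤ ∑' n, P (g n)

theorem IsBanachENorm.zero' {E : Type*} [AddCommGroup E] [Module ℂ E] {N : E → ℝ≥0∞}
    (h : IsBanachENorm ℂ N) : N 0 = 0 := by
  have := h.2.2.1 0 0
  simpa using this

theorem IsBanachENorm.neg' {E : Type*} [AddCommGroup E] [Module ℂ E] {N : E → ℝ≥0∞}
    (h : IsBanachENorm ℂ N) (x : E) : N (-x) ≤ N x := by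
  have := h.2.2.1 (-1) x
  simpa using this

theorem IsBanachENorm.sum' {E : Type*} [AddCommGroup E] [Module ℂ E] {N : E → ℝ≥0∞}
    (h : IsBanachENorm ℂ N) {ι : Type*} (s : Finset ι) (f : ι → E) :
    N (∑ i ∈ s, f i) ≤ ∑ i ∈ s, N (f i) := by
  classical
  induction s using Finset.induction_on with
  | empty => simp [h.zero']
  | insert a s ha ih =>
    rw [Finset.sum_insert ha, Finset.sum_insert ha]
    exact (h.2.1 _ _).trans (by gcongr)

theorem banach_tsum {E : Type*} [NormedAddCommGroup E] [NormedSpace ℂ E]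
    {Q : (ℤ → E) → ℝ≥0∞} (h : IsBanachENorm ℂ Q) (hc : ∀ x k, ‖x k‖ₑ ≤ Q x)
    (g : ℕ → ℤ → E) (s : ℤ → E) (hfin : ∑' n, Q (g n) ≠ ∞)
    (hs : ∀ k, HasSum (fun n => g n k) (s k)) : Q s ≤ ∑' n, Q (g n) := by
  set G : ℕ → ℤ → E := fun n => ∑ i ∈ Finset.range n, g i with hG
  have hGle : ∀ n, Q (G n) ≤ ∑' n, Q (g n) := fun n =>
    (h.sum' _ _).trans (ENNReal.sum_le_tsum _)
  have key : ∀ m n, m ≤ n → Q (G n - G m) ≤ ∑' i, Q (g (i + m)) := by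
    intro m n hmn
    have : G n - G m = ∑ i ∈ Finset.range (n - m), g (i + m) := by
      rw [hG]
      simp only
      rw [← Finset.sum_Ico_eq_sub _ hmn, Finset.sum_Ico_eq_sum_range]
      simp [add_comm]
    rw [this]
    exact (h.sum' _ _).trans (ENNReal.sum_le_tsum _)
  have htail := ENNReal.tendsto_sum_nat_add (fun n => Q (g n)) hfin
  obtain ⟨z, hz, hzt⟩ := h.2.2.2 G (fun n => ne_top_of_le_ne_top hfin (hGle n)) (by
    intro ε hε
    obtain ⟨n₀, hn₀⟩ := ((tendsto_order.1 htail).2 ε hε).exists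
    refine ⟨n₀, fun m hm n hn => ?_⟩
    have mono : ∀ p, n₀ ≤ p → ∑' i, Q (g (i + p)) ≤ ∑' i, Q (g (i + n₀)) := by
      intro p hp
      obtain ⟨q, rfl⟩ := Nat.exists_eq_add_of_le hp
      have := ENNReal.tsum_comp_le_tsum_of_injective (f := fun i : ℕ => i + q)
        (add_left_injective q) (fun i => Q (g (i + n₀)))
      refine le_trans (le_of_eq ?_) this
      congr 1; ext i; congr 2; ring
    rcases le_total m n with hmn | hmn
    · rw [← neg_sub]
      exact (h.neg' _).trans_lt (((key m n hmn).trans (mono m hm)).trans_lt hn₀)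
    · exact (((key n m hmn).trans (mono n hn)).trans_lt hn₀))
  have hzs : z = s := by
    ext k
    have h1 : Tendsto (fun n => G n k) atTop (𝓝 (s k)) := by
      have := (hs k).tendsto_sum_nat
      simpa [hG, Finset.sum_apply] using this
    have h2 : Tendsto (fun n => G n k) atTop (𝓝 (z k)) := by
      rw [tendsto_iff_edist_tendsto_0]
      refine tendsto_of_tendsto_of_tendsto_of_le_of_le tendsto_const_nhds hzt
        (fun _ => zero_le) (fun n => ?_)
      have := hc (G n - z) k
      simpa [edist_eq_enorm_sub] using this
    exact tendsto_nhds_unique h2 h1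
  subst hzs
  have : Tendsto (fun n => (∑' n, Q (g n)) + Q (G n - z)) atTop (𝓝 ((∑' n, Q (g n)) + 0)) :=
    tendsto_const_nhds.add hzt
  rw [add_zero] at this
  refine ge_of_tendsto' this (fun n => ?_)
  have e : z = G n + -(G n - z) := by abel
  calc Q z = Q (G n + -(G n - z)) := by rw [← e]
    _ ≤ Q (G n) + Q (-(G n - z)) := h.2.1 _ _
    _ ≤ _ := add_le_add (hGle n) (h.neg' _)

theorem enSum_norm_le {E : Type*} [NormedAddCommGroup E] [NormedSpace ℂ E]
    (N₀ N₁ : BanachENorm ℂ E)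
    (h : ∀ v : E, enSum N₀.toFun N₁.toFun v = (‖v‖₊ : ℝ≥0∞)) (v : E) :
    ‖v‖ₑ ≤ N₀.toFun v ∧ ‖v‖ₑ ≤ N₁.toFun v := by
  have e : ‖v‖ₑ = enSum N₀.toFun N₁.toFun v := (h v).symm
  rw [e]
  constructor
  · refine (iInf_le _ v).trans ?_
    simp [N₁.isBanachENorm.zero']
  · refine (iInf_le _ 0).trans ?_
    simp [N₀.isBanachENorm.zero']

theorem WS.of {E : Type*} [NormedAddCommGroup E] [NormedSpace ℂ E]
    (X : BanachENorm ℂ E) (hX : ∀ v, ‖v‖ₑ ≤ X.toFun v) (S : SeqStructure ℂ E X) (a : ℝ)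
    (ha : 0 < a) : WS X.toFun a (wtSeq a S.toFun) := by
  have hN := X.isBanachENorm
  have hS := S.isBanachENorm
  have hsm : ∀ (r : ℝ) (x : ℤ → E), 0 ≤ r → S.toFun (r • x) ≤ ENNReal.ofReal r * S.toFun x := by
    intro r x hr
    have := hS.2.2.1 (r : ℂ) x
    rw [Complex.coe_smul] at this
    refine this.trans (le_of_eq ?_)
    congr 1
    change ‖(r : ℂ)‖ₑ = _
    rw [← ofReal_norm, Complex.norm_real, Real.norm_of_nonneg hr]
  have hsmX : ∀ (r : ℝ) (x : E), 0 ≤ r → X.toFun (r • x) ≤ ENNReal.ofReal r * X.toFun x := by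
    intro r x hr
    have := hN.2.2.1 (r : ℂ) x
    rw [Complex.coe_smul] at this
    refine this.trans (le_of_eq ?_)
    congr 1
    change ‖(r : ℂ)‖ₑ = _
    rw [← ofReal_norm, Complex.norm_real, Real.norm_of_nonneg hr]
  refine ⟨ha, hX, hN.2.1, hN.2.2.1, ?_, ?_, ?_, ?_, ?_, ?_⟩
  · intro x y
    refine le_trans (le_of_eq ?_) (hS.2.1 _ _)
    unfold wtSeq; congr 1; ext k; simp
  · intro c x
    refine le_trans (le_of_eq ?_) (hS.2.2.1 c _)
    unfold wtSeq; congr 1; ext k; exact smul_comm _ _ _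
  · intro v n
    have : (fun k : ℤ => a ^ k • (if k = n then v else 0)) =
        fun k => if k = n then a ^ n • v else 0 := by
      ext k; split_ifs with h
      · rw [h]
      · simp
    unfold wtSeq
    rw [this, S.single]
    exact hsmX _ _ (by positivity)
  · intro x n
    have : (fun k : ℤ => a ^ k • x (k + n)) =
        a ^ (-n) • fun k => (fun k => a ^ k • x k) (k + n) := by
      ext k
      simp only [Pi.smul_apply, smul_smul]
      rw [← zpow_add₀ ha.ne']; congr 2; ring
    unfold wtSeq
    rw [this]
    refine (hsm _ _ (by positivity)).trans ?_
    rw [S.shift (fun k => a ^ k • x k) n]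
  · intro x k
    have : x k = a ^ (-k) • (fun k => a ^ k • x k) k := by
      simp only [smul_smul]
      rw [← zpow_add₀ ha.ne']; simp
    rw [this]
    refine (hsmX _ _ (by positivity)).trans ?_
    gcongr
    exact S.coord _ _
  · intro g s hfin hs
    refine banach_tsum hS (fun x k => (hX _).trans (S.coord x k)) (fun n k => a ^ k • g n k) _
      hfin (fun k => ?_)
    exact (hs k).const_smul _

theorem wtSeq_cesaro {E : Type*} [NormedAddCommGroup E] [NormedSpace ℂ E]
    (a : ℝ) (S : (ℤ → E) → ℝ≥0∞) (n : ℕ) (x : ℤ → E) :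
    wtSeq a S (cesaro ℂ n x) = S (cesaro ℂ n (fun k => a ^ k • x k)) := by
  unfold wtSeq cesaro
  congr 1; ext k
  rw [smul_comm, Finset.smul_sum]
  congr 2; ext m; split_ifs <;> simp


/-- The interpolation norm in terms of weighted sequence norms. -/
noncomputable def JN {E : Type*} [NormedAddCommGroup E] (P₀ P₁ : (ℤ → E) → ℝ≥0∞) (v : E) :
    ℝ≥0∞ := ⨅ (x : ℤ → E) (_ : HasSum x v), max (P₀ x) (P₁ x)

theorem JN_le {E : Type*} [NormedAddCommGroup E] {P₀ P₁ : (ℤ → E) → ℝ≥0∞} {v : E} {x : ℤ → E}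
    (h : HasSum x v) : JN P₀ P₁ v ≤ max (P₀ x) (P₁ x) := iInf₂_le x h

theorem JN_lt {E : Type*} [NormedAddCommGroup E] {P₀ P₁ : (ℤ → E) → ℝ≥0∞} {v : E} {b : ℝ≥0∞}
    (h : JN P₀ P₁ v < b) : ∃ x, HasSum x v ∧ P₀ x < b ∧ P₁ x < b := by
  unfold JN at h
  simp only [iInf_lt_iff] at h
  obtain ⟨x, hx, h⟩ := h
  exact ⟨x, hx, max_lt_iff.1 h⟩

/-- Geometric constant. -/
noncomputable def Lc (θ : ℝ) : ℝ≥0∞ := ∑' k : ℤ, ENNReal.ofReal (Real.exp (-(min θ (1 - θ)) * |(k : ℝ)|))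

theorem Lc_ne_top {θ : ℝ} (hθ : θ ∈ Set.Ioo (0 : ℝ) 1) : Lc θ ≠ ∞ := by
  have hc : 0 < min θ (1 - θ) := lt_min hθ.1 (by linarith [hθ.2])
  set c := min θ (1 - θ)
  have hn : Summable (fun n : ℕ => Real.exp (-c * n)) := by
    have := Real.summable_exp_nat_mul_iff (a := -c)
    simpa [mul_comm] using this.2 (by linarith)
  have : Summable (fun k : ℤ => Real.exp (-c * |(k : ℝ)|)) := by
    apply Summable.of_nat_of_neg
    · simpa using hn
    · simpa using hn
  exact this.tsum_ofReal_ne_top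

section
variable {E : Type*} [NormedAddCommGroup E] [NormedSpace ℂ E] {θ : ℝ}
  {N₀ N₁ : E → ℝ≥0∞} {P₀ P₁ : (ℤ → E) → ℝ≥0∞}

theorem WS.zero {a : ℝ} (h₀ : WS N₀ a P₀) : P₀ 0 = 0 := by
  simpa using h₀.smul_le 0 0

theorem WS.neg {a : ℝ} (h₀ : WS N₀ a P₀) (x : ℤ → E) : P₀ (-x) ≤ P₀ x := by
  simpa using h₀.smul_le (-1) x

theorem WS.Nzero {a : ℝ} (h₀ : WS N₀ a P₀) : N₀ 0 = 0 := by
  simpa using h₀.Nsmul 0 0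

theorem WS.Nneg {a : ℝ} (h₀ : WS N₀ a P₀) (x : E) : N₀ (-x) ≤ N₀ x := by
  simpa using h₀.Nsmul (-1) x

theorem WS.Nsum {a : ℝ} (h : WS N₀ a P₀) {ι : Type*} (s : Finset ι) (f : ι → E) :
    N₀ (∑ i ∈ s, f i) ≤ ∑ i ∈ s, N₀ (f i) := by
  classical
  induction s using Finset.induction_on with
  | empty => simp [h.Nzero]
  | insert a s ha ih =>
    rw [Finset.sum_insert ha, Finset.sum_insert ha]
    exact (h.Nadd _ _).trans (by gcongr)

theorem WS.sum {a : ℝ} (h : WS N₀ a P₀) {ι : Type*} (s : Finset ι) (f : ι → ℤ → E) :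
    P₀ (∑ i ∈ s, f i) ≤ ∑ i ∈ s, P₀ (f i) := by
  classical
  induction s using Finset.induction_on with
  | empty => simp [h.zero]
  | insert a s ha ih =>
    rw [Finset.sum_insert ha, Finset.sum_insert ha]
    exact (h.add_le _ _).trans (by gcongr)

theorem exp_zpow' (t : ℝ) (k : ℤ) : Real.exp t ^ k = Real.exp (t * k) := by
  rw [Real.exp_mul, Real.rpow_intCast]

theorem tsum_enorm_le (hθ : θ ∈ Set.Ioo (0 : ℝ) 1)
    (h₀ : WS N₀ (Real.exp (-θ)) P₀) (h₁ : WS N₁ (Real.exp (1 - θ)) P₁) (x : ℤ → E) :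
    ∑' k, ‖x k‖ₑ ≤ Lc θ * max (P₀ x) (P₁ x) := by
  rw [Lc, ← ENNReal.tsum_mul_right]
  refine ENNReal.tsum_le_tsum fun k => ?_
  rcases le_total 0 k with hk | hk
  · refine (h₁.norm_le _).trans ((h₁.coord x k).trans ?_)
    gcongr
    · rw [exp_zpow']
      apply Real.exp_le_exp.2
      have hk' : (0 : ℝ) ≤ k := by exact_mod_cast hk
      rw [abs_of_nonneg hk']
      push_cast
      nlinarith [min_le_right θ (1 - θ)]
    · exact le_max_right _ _
  · refine (h₀.norm_le _).trans ((h₀.coord x k).trans ?_)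
    gcongr
    · rw [exp_zpow']
      apply Real.exp_le_exp.2
      have hk' : (k : ℝ) ≤ 0 := by exact_mod_cast hk
      rw [abs_of_nonpos hk']
      push_cast
      nlinarith [min_le_left θ (1 - θ)]
    · exact le_max_left _ _

theorem summable_norm_of_ws (hθ : θ ∈ Set.Ioo (0 : ℝ) 1)
    (h₀ : WS N₀ (Real.exp (-θ)) P₀) (h₁ : WS N₁ (Real.exp (1 - θ)) P₁) (x : ℤ → E)
    (hx₀ : P₀ x ≠ ∞) (hx₁ : P₁ x ≠ ∞) : Summable (fun k => ‖x k‖) := by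
  have := tsum_enorm_le hθ h₀ h₁ x
  have h2 : ∑' k, ‖x k‖ₑ ≠ ∞ := ne_top_of_le_ne_top
    (ENNReal.mul_ne_top (Lc_ne_top hθ) (by simp [hx₀, hx₁])) this
  have h3 := ENNReal.summable_toReal h2
  simpa using h3

theorem JN_norm_le (hθ : θ ∈ Set.Ioo (0 : ℝ) 1)
    (h₀ : WS N₀ (Real.exp (-θ)) P₀) (h₁ : WS N₁ (Real.exp (1 - θ)) P₁) (v : E) :
    ‖v‖ₑ ≤ Lc θ * JN P₀ P₁ v := by
  by_cases hJ : JN P₀ P₁ v = ∞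
  · have : Lc θ ≠ 0 := by
      intro h0
      rw [Lc, ENNReal.tsum_eq_zero] at h0
      have := h0 0
      simp at this
    rw [hJ, ENNReal.mul_top this]; exact le_top
  have : ∀ x : ℤ → E, HasSum x v → ‖v‖ₑ ≤ Lc θ * max (P₀ x) (P₁ x) := by
    intro x hx
    refine le_trans ?_ (tsum_enorm_le hθ h₀ h₁ x)
    rw [← hx.tsum_eq]
    exact enorm_tsum_le_tsum_enorm
  refine ENNReal.le_of_forall_pos_le_add fun ε hε _ => ?_
  have hL := Lc_ne_top hθ
  have hδ : JN P₀ P₁ v < JN P₀ P₁ v + ε / (Lc θ + 1) :=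
    ENNReal.lt_add_right hJ (by
      have : Lc θ + 1 ≠ ∞ := by simp [hL]
      simp [hε.ne', this])
  obtain ⟨x, hx, hx0, hx1⟩ := JN_lt hδ
  refine (this x hx).trans ((mul_le_mul_right (max_le hx0.le hx1.le) _).trans ?_)
  rw [mul_add]
  gcongr
  refine (mul_le_mul_left (b := Lc θ) (c := Lc θ + 1) le_self_add _).trans ?_
  exact ENNReal.mul_div_le

theorem JN_add (h₀ : WS N₀ (Real.exp (-θ)) P₀) (h₁ : WS N₁ (Real.exp (1 - θ)) P₁) (v w : E) :
    JN P₀ P₁ (v + w) ≤ JN P₀ P₁ v + JN P₀ P₁ w := by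
  refine ENNReal.le_of_forall_pos_le_add fun ε hε hfin => ?_
  have hv : JN P₀ P₁ v ≠ ∞ := fun h => by simp [h] at hfin
  have hw : JN P₀ P₁ w ≠ ∞ := fun h => by simp [h] at hfin
  have hε2 : (ε / 2 : ℝ≥0∞) ≠ 0 := by simp [hε.ne']
  obtain ⟨x, hx, hx0, hx1⟩ := JN_lt (ENNReal.lt_add_right hv hε2)
  obtain ⟨y, hy, hy0, hy1⟩ := JN_lt (ENNReal.lt_add_right hw hε2)
  refine (JN_le (hx.add hy)).trans (max_le ?_ ?_)
  · refine (h₀.add_le x y).trans ((add_le_add hx0.le hy0.le).trans (le_of_eq ?_))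
    rw [add_add_add_comm, ENNReal.add_halves]
  · refine (h₁.add_le x y).trans ((add_le_add hx1.le hy1.le).trans (le_of_eq ?_))
    rw [add_add_add_comm, ENNReal.add_halves]

theorem JN_zero (h₀ : WS N₀ (Real.exp (-θ)) P₀) (h₁ : WS N₁ (Real.exp (1 - θ)) P₁) :
    JN P₀ P₁ (0 : E) = 0 := by
  have := JN_le (P₀ := P₀) (P₁ := P₁) (hasSum_zero (α := E) (β := ℤ))
  have e : (fun _ : ℤ => (0 : E)) = 0 := rfl
  rw [e, h₀.zero, h₁.zero] at this
  simpa using this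

theorem JN_smul (h₀ : WS N₀ (Real.exp (-θ)) P₀) (h₁ : WS N₁ (Real.exp (1 - θ)) P₁) (c : ℂ)
    (v : E) : JN P₀ P₁ (c • v) ≤ ‖c‖ₑ * JN P₀ P₁ v := by
  by_cases hc : c = 0
  · simp [hc, JN_zero h₀ h₁]
  have hc0 : ‖c‖ₑ ≠ 0 := by simpa using hc
  have hc1 : ‖c‖ₑ ≠ ∞ := enorm_ne_top
  unfold JN
  rw [ENNReal.mul_iInf_of_ne hc0 hc1]
  refine le_iInf fun x => ?_
  rw [ENNReal.mul_iInf_of_ne hc0 hc1]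
  refine le_iInf fun hx => ?_
  refine (JN_le (hx.const_smul c)).trans ?_
  refine max_le ((h₀.smul_le c x).trans ?_) ((h₁.smul_le c x).trans ?_)
  · gcongr; exact le_max_left _ _
  · gcongr; exact le_max_right _ _

theorem JN_neg (h₀ : WS N₀ (Real.exp (-θ)) P₀) (h₁ : WS N₁ (Real.exp (1 - θ)) P₁)
    (v : E) : JN P₀ P₁ (-v) ≤ JN P₀ P₁ v := by
  simpa using JN_smul h₀ h₁ (-1) v

theorem JN_single (h₀ : WS N₀ (Real.exp (-θ)) P₀) (h₁ : WS N₁ (Real.exp (1 - θ)) P₁) (v : E) :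
    JN P₀ P₁ v ≤ max (N₀ v) (N₁ v) := by
  refine (JN_le (hasSum_ite_eq (0 : ℤ) v)).trans (max_le_max ?_ ?_)
  · simpa using h₀.single v 0
  · simpa using h₁.single v 0

theorem JN_shift (h₀ : WS N₀ (Real.exp (-θ)) P₀) (h₁ : WS N₁ (Real.exp (1 - θ)) P₁) (v : E)
    (x : ℤ → E) (hx : HasSum x v) (n : ℤ) :
    JN P₀ P₁ v ≤ max (ENNReal.ofReal (Real.exp (θ * n)) * P₀ x)
      (ENNReal.ofReal (Real.exp (-(1 - θ) * n)) * P₁ x) := by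
  have : HasSum (fun k => x (k + n)) v := (Equiv.addRight n).hasSum_iff.2 hx
  refine (JN_le this).trans (max_le_max ?_ ?_)
  · refine (h₀.shift x n).trans (le_of_eq ?_)
    rw [exp_zpow']; congr 3; push_cast; ring
  · refine (h₁.shift x n).trans (le_of_eq ?_)
    rw [exp_zpow']; congr 3; push_cast; ring

theorem JN_tsum [CompleteSpace E] (hθ : θ ∈ Set.Ioo (0 : ℝ) 1)
    (h₀ : WS N₀ (Real.exp (-θ)) P₀) (h₁ : WS N₁ (Real.exp (1 - θ)) P₁)
    (y : ℕ → E) (v : E) (hy : HasSum y v) :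
    JN P₀ P₁ v ≤ ∑' n, JN P₀ P₁ (y n) := by
  refine ENNReal.le_of_forall_pos_le_add fun ε hε hfin => ?_
  obtain ⟨δ, hδ, hδs⟩ := ENNReal.exists_pos_sum_of_countable (ε := (ε : ℝ≥0∞))
    (by simpa using hε.ne') ℕ
  have hJ : ∀ n, JN P₀ P₁ (y n) ≠ ∞ := fun n => ENNReal.ne_top_of_tsum_ne_top hfin.ne n
  have hex : ∀ n, ∃ x, HasSum x (y n) ∧ P₀ x < JN P₀ P₁ (y n) + δ n ∧
      P₁ x < JN P₀ P₁ (y n) + δ n := fun n =>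
    JN_lt (ENNReal.lt_add_right (hJ n) (by simpa using (hδ n).ne'))
  choose w hw hw0 hw1 using hex
  set B : ℝ≥0∞ := ∑' n, (JN P₀ P₁ (y n) + δ n) with hB
  have hBle : B ≤ (∑' n, JN P₀ P₁ (y n)) + ε := by
    rw [hB, ENNReal.tsum_add]
    gcongr
  have hBfin : B ≠ ∞ := ne_top_of_le_ne_top (by simp [hfin.ne]) hBle
  have hS0 : ∑' n, P₀ (w n) ≤ B := ENNReal.tsum_le_tsum fun n => (hw0 n).le
  have hS1 : ∑' n, P₁ (w n) ≤ B := ENNReal.tsum_le_tsum fun n => (hw1 n).le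
  have hdbl : ∑' p : ℕ × ℤ, ‖w p.1 p.2‖ₑ ≠ ∞ := by
    rw [ENNReal.tsum_prod (f := fun n k => ‖w n k‖ₑ)]
    refine ne_top_of_le_ne_top (ENNReal.mul_ne_top (Lc_ne_top hθ) hBfin) ?_
    rw [hB, ← ENNReal.tsum_mul_left]
    refine ENNReal.tsum_le_tsum fun n => (tsum_enorm_le hθ h₀ h₁ (w n)).trans ?_
    gcongr
    exact max_le (hw0 n).le (hw1 n).le
  have hsum : Summable (fun p : ℕ × ℤ => w p.1 p.2) := by
    have h3 := ENNReal.summable_toReal hdbl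
    simp only [toReal_enorm] at h3
    exact h3.of_norm
  have htot : HasSum (fun p : ℕ × ℤ => w p.1 p.2) v := by
    have h1 := hsum.hasSum.prod_fiberwise (fun n => hw n)
    rw [← h1.unique hy]
    exact hsum.hasSum
  have hsum' : Summable (fun p : ℤ × ℕ => w p.2 p.1) := hsum.prod_symm
  have hfib : ∀ k, HasSum (fun n => w n k) (∑' n, w n k) := fun k =>
    (hsum'.prod_factor k).hasSum
  have htot' : HasSum (fun p : ℤ × ℕ => w p.2 p.1) v :=
    (Equiv.prodComm ℤ ℕ).hasSum_iff.2 htot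
  have hv := htot'.prod_fiberwise hfib
  refine (JN_le hv).trans (le_trans (max_le ?_ ?_) hBle)
  · exact (h₀.tsum w _ (ne_top_of_le_ne_top hBfin hS0) hfib).trans hS0
  · exact (h₁.tsum w _ (ne_top_of_le_ne_top hBfin hS1) hfib).trans hS1

end


/-- Cesàro weights. -/
noncomputable def cw (n : ℕ) (k : ℤ) : ℂ :=
  (n + 1 : ℂ)⁻¹ * ∑ m ∈ Finset.range (n + 1), (if |k| ≤ (m : ℤ) then 1 else 0)

theorem cesaro_eq_cw {E : Type*} [NormedAddCommGroup E] [NormedSpace ℂ E] (n : ℕ) (x : ℤ → E)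
    (k : ℤ) : cesaro ℂ n x k = cw n k • x k := by
  unfold cesaro cw
  rw [mul_smul, Finset.sum_smul]
  congr 2; ext m; split_ifs <;> simp

theorem cw_eq_zero {n : ℕ} {k : ℤ} (h : (n : ℤ) + 1 ≤ |k|) : cw n k = 0 := by
  unfold cw
  rw [Finset.sum_eq_zero, mul_zero]
  intro m hm
  rw [Finset.mem_range] at hm
  rw [if_neg]
  omega

theorem one_sub_cw (n : ℕ) (k : ℤ) : ‖1 - cw n k‖ₑ ≤ ENNReal.ofReal ((n + 1 : ℝ)⁻¹ * |(k : ℝ)|) := by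
  have hn : (n + 1 : ℂ) ≠ 0 := by exact_mod_cast Nat.succ_ne_zero n
  have e : 1 - cw n k = (n + 1 : ℂ)⁻¹ *
      ((Finset.range (n + 1)).filter (fun m : ℕ => ¬ |k| ≤ (m : ℤ))).card := by
    unfold cw
    have h1 : ((Finset.range (n + 1)).filter (fun m : ℕ => |k| ≤ (m : ℤ))).card +
      ((Finset.range (n + 1)).filter (fun m : ℕ => ¬ |k| ≤ (m : ℤ))).card = n + 1 := by
      rw [Finset.card_filter_add_card_filter_not]; simp
    have h2 : ((((Finset.range (n + 1)).filter (fun m : ℕ => |k| ≤ (m : ℤ))).card : ℕ) : ℂ) +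
      (((Finset.range (n + 1)).filter (fun m : ℕ => ¬ |k| ≤ (m : ℤ))).card : ℕ) = n + 1 := by
      exact_mod_cast h1
    rw [Finset.sum_boole]
    field_simp
    rw [← h2]; ring
  rw [e, ← ofReal_norm]
  apply ENNReal.ofReal_le_ofReal
  rw [norm_mul, norm_inv]
  have h3 : ‖(n + 1 : ℂ)‖ = n + 1 := by
    have := Complex.norm_natCast (n + 1)
    simpa using this
  rw [h3, Complex.norm_natCast]
  gcongr
  have h4 : ((Finset.range (n + 1)).filter (fun m : ℕ => ¬ |k| ≤ (m : ℤ))).card ≤ k.natAbs := by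
    calc _ ≤ (Finset.range k.natAbs).card := by
          apply Finset.card_le_card
          intro m hm
          simp only [Finset.mem_filter, Finset.mem_range] at hm ⊢
          rw [Int.abs_eq_natAbs] at hm
          omega
      _ = _ := by simp
  calc ((_ : ℕ) : ℝ) ≤ (k.natAbs : ℝ) := by exact_mod_cast h4
    _ = |(k : ℝ)| := by rw [Nat.cast_natAbs]; simp

theorem tele_int {E : Type*} [AddCommGroup E] (f : ℤ → E) (R : ℤ) (n : ℕ) :
    ∑ k ∈ Finset.Ico R (R + n), (f (k + 1) - f k) = f (R + n) - f R := by
  induction n with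
  | zero => simp
  | succ n ih =>
    have : Finset.Ico R (R + (n + 1 : ℕ)) = insert (R + n) (Finset.Ico R (R + n)) := by
      ext j; simp only [Finset.mem_Ico, Finset.mem_insert]; push_cast; omega
    rw [this, Finset.sum_insert (by simp), ih]
    push_cast
    rw [add_assoc]; abel

section
variable {E : Type*} [NormedAddCommGroup E] [NormedSpace ℂ E] {θ : ℝ}
  {N₀ N₁ : E → ℝ≥0∞} {P₀ P₁ : (ℤ → E) → ℝ≥0∞}

theorem WS.conv {N : E → ℝ≥0∞} {P : (ℤ → E) → ℝ≥0∞} {a : ℝ} (h : WS N a P) (e : ℕ → ℤ)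
    (hs : ∑' m, ENNReal.ofReal (a ^ (- e m)) ≠ ∞) (x u : ℤ → E) (hx : P x ≠ ∞)
    (hu : ∀ k, HasSum (fun m => x (k + e m)) (u k)) :
    P u ≤ (∑' m, ENNReal.ofReal (a ^ (- e m))) * P x := by
  have h1 : ∑' m, P (fun k => x (k + e m)) ≤ (∑' m, ENNReal.ofReal (a ^ (- e m))) * P x := by
    rw [← ENNReal.tsum_mul_right]
    exact ENNReal.tsum_le_tsum fun m => h.shift x (e m)
  exact (h.tsum (fun m k => x (k + e m)) u
    (ne_top_of_le_ne_top (ENNReal.mul_ne_top hs hx) h1) hu).trans h1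

theorem WS.rem {N : E → ℝ≥0∞} {P : (ℤ → E) → ℝ≥0∞} {a : ℝ} (h : WS N a P) (e : ℕ → ℤ)
    (he : Function.Injective e) (r : ℤ → E) (n : ℕ) (v : E)
    (hr : ∀ m, r (e m) = (1 - cw n (e m)) • v) (hr' : ∀ k, k ∉ Set.range e → r k = 0) :
    P r ≤ ENNReal.ofReal ((n + 1 : ℝ)⁻¹) *
      ((∑' m, ENNReal.ofReal (a ^ (e m) * |(e m : ℝ)|)) * N v) := by
  set g : ℕ → ℤ → E := fun m k => if k = e m then (1 - cw n (e m)) • v else 0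
  have ha := h.apos
  have h1 : ∑' m, P (g m) ≤ ENNReal.ofReal ((n + 1 : ℝ)⁻¹) *
      ((∑' m, ENNReal.ofReal (a ^ (e m) * |(e m : ℝ)|)) * N v) := by
    rw [← ENNReal.tsum_mul_right, ← ENNReal.tsum_mul_left]
    refine ENNReal.tsum_le_tsum fun m => ?_
    refine (h.single _ _).trans ?_
    calc _ ≤ ENNReal.ofReal (a ^ e m) * (ENNReal.ofReal ((n + 1 : ℝ)⁻¹ * |(e m : ℝ)|) * N v) := by
          gcongr
          refine (h.Nsmul _ _).trans ?_
          gcongr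
          exact one_sub_cw n (e m)
      _ = _ := by
          rw [ENNReal.ofReal_mul (by positivity), ENNReal.ofReal_mul (by positivity)]
          ring
  by_cases hfin : ∑' m, P (g m) = ∞
  · rw [hfin] at h1
    exact le_top.trans h1
  refine (h.tsum g r hfin fun k => ?_).trans h1
  by_cases hk : k ∈ Set.range e
  · obtain ⟨m, rfl⟩ := hk
    rw [hr]
    have := hasSum_single (f := fun m' => g m' (e m)) m (fun m' hm' => by
      simp only [g]
      rw [if_neg]
      intro hh
      exact hm' (he hh).symm)
    simpa [g] using this
  · rw [hr' k hk]
    have : (fun m => g m k) = fun _ => 0 := by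
      ext m
      simp only [g]
      rw [if_neg]
      rintro rfl
      exact hk ⟨m, rfl⟩
    rw [this]; exact hasSum_zero

/-- The constant of one endpoint. -/
noncomputable def Kend (a : ℝ) (e : ℕ → ℤ) : ℝ≥0∞ :=
  (ENNReal.ofReal (a ^ (-1 : ℤ)) + 1) * ∑' m, ENNReal.ofReal (a ^ (- e m))

theorem end_bound {N : E → ℝ≥0∞} {P : (ℤ → E) → ℝ≥0∞} {a : ℝ} (h : WS N a P) (e e' : ℕ → ℤ)
    (he : Function.Injective e')
    (hs : ∑' m, ENNReal.ofReal (a ^ (- e m)) ≠ ∞)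
    (hs' : ∑' m, ENNReal.ofReal (a ^ (e' m) * |(e' m : ℝ)|) ≠ ∞)
    (hc : ∀ n x, P (cesaro ℂ n x) ≤ P x)
    (x u : ℤ → E) (hx : P x ≠ ∞) (v : E) (hv : N v ≠ ∞)
    (hu : ∀ k, HasSum (fun m => x (k + e m)) (u k)) (ε : ℝ≥0∞) (hε : 0 < ε) :
    ∀ᶠ n in atTop, ∀ r : ℤ → E, (∀ m, r (e' m) = (1 - cw n (e' m)) • v) →
      (∀ k, k ∉ Set.range e' → r k = 0) →
      P (fun k => (cesaro ℂ n u + r) (k + 1) - (cesaro ℂ n u + r) k) ≤ Kend a e * P x + ε := by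
  have ht : Tendsto (fun n : ℕ => (ENNReal.ofReal (a ^ (-1 : ℤ)) + 1) *
      (ENNReal.ofReal ((n + 1 : ℝ)⁻¹) *
      ((∑' m, ENNReal.ofReal (a ^ (e' m) * |(e' m : ℝ)|)) * N v))) atTop (𝓝 0) := by
    have h1 : Tendsto (fun n : ℕ => ENNReal.ofReal ((n + 1 : ℝ)⁻¹)) atTop (𝓝 0) := by
      have := ENNReal.tendsto_ofReal (tendsto_one_div_add_atTop_nhds_zero_nat (𝕜 := ℝ))
      simpa using this
    have h2 := ENNReal.Tendsto.mul_const h1 (b := (∑' m, ENNReal.ofReal (a ^ (e' m) * |(e' m : ℝ)|)) * N v)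
      (Or.inr (ENNReal.mul_ne_top hs' hv))
    have h3 := ENNReal.Tendsto.const_mul h2 (a := ENNReal.ofReal (a ^ (-1 : ℤ)) + 1) (Or.inr (by simp))
    simpa using h3
  filter_upwards [(tendsto_order.1 ht).2 ε hε] with n hn r hr hr'
  have hb : P (cesaro ℂ n u + r) ≤ (∑' m, ENNReal.ofReal (a ^ (- e m))) * P x +
      ENNReal.ofReal ((n + 1 : ℝ)⁻¹) *
      ((∑' m, ENNReal.ofReal (a ^ (e' m) * |(e' m : ℝ)|)) * N v) :=
    (h.add_le _ _).trans (add_le_add ((hc n u).trans (h.conv e hs x u hx hu))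
      (h.rem e' he r n v hr hr'))
  set U := cesaro ℂ n u + r
  have : (fun k => U (k + 1) - U k) = (fun k => U (k + 1)) + -U := by
    ext k; simp [sub_eq_add_neg]
  rw [this]
  calc _ ≤ ENNReal.ofReal (a ^ (-1 : ℤ)) * P U + P U :=
        (h.add_le _ _).trans (add_le_add (h.shift U 1) (h.neg U))
    _ = (ENNReal.ofReal (a ^ (-1 : ℤ)) + 1) * P U := by ring
    _ ≤ _ := mul_le_mul_right hb _
    _ ≤ _ := by
      rw [mul_add, ← mul_assoc]
      exact add_le_add le_rfl hn.le

/-- Negative exponents. -/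
def eneg (m : ℕ) : ℤ := -(m + 1)

/-- The constant. -/
noncomputable def Kc (θ : ℝ) : ℝ≥0∞ :=
  Kend (Real.exp (-θ)) eneg + Kend (Real.exp (1 - θ)) (fun m => m)

theorem sum0 {r : ℝ} (h0 : 0 < r) (h1 : r < 1) :
    ∑' m : ℕ, ENNReal.ofReal (r ^ m) ≠ ∞ :=
  (summable_geometric_of_lt_one h0.le h1).tsum_ofReal_ne_top

theorem sum0' {r : ℝ} (h0 : 0 < r) (h1 : r < 1) :
    ∑' m : ℕ, ENNReal.ofReal (r ^ m * m) ≠ ∞ := by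
  have := summable_pow_mul_geometric_of_norm_lt_one (R := ℝ) 1 (r := r)
    (by rw [Real.norm_of_nonneg h0.le]; exact h1)
  have h2 : Summable (fun m : ℕ => r ^ m * m) := by
    simpa [mul_comm] using this
  exact h2.tsum_ofReal_ne_top

theorem sum0s {r : ℝ} (h0 : 0 < r) (h1 : r < 1) :
    ∑' m : ℕ, ENNReal.ofReal (r ^ (-eneg m)) ≠ ∞ := by
  have := ENNReal.tsum_comp_le_tsum_of_injective (f := fun i : ℕ => i + 1)
        (add_left_injective 1) (fun m => ENNReal.ofReal (r ^ m))
  refine ne_top_of_le_ne_top (sum0 h0 h1) (le_trans (le_of_eq ?_) this)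
  congr 1

theorem sum0s' {r : ℝ} (h0 : 0 < r) (h1 : r < 1) :
    ∑' m : ℕ, ENNReal.ofReal (r ^ ((m : ℤ) + 1) * |(((m : ℤ) + 1 : ℤ) : ℝ)|) ≠ ∞ := by
  have := ENNReal.tsum_comp_le_tsum_of_injective (f := fun i : ℕ => i + 1)
        (add_left_injective 1) (fun m : ℕ => ENNReal.ofReal (r ^ m * m))
  refine ne_top_of_le_ne_top (sum0' h0 h1) (le_trans (le_of_eq ?_) this)
  congr 1; ext m
  congr 1
  push_cast
  rw [abs_of_nonneg (by positivity)]; norm_cast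

theorem Kc_ne_top {θ : ℝ} (hθ : θ ∈ Set.Ioo (0 : ℝ) 1) : Kc θ ≠ ∞ := by
  have hθ1 := hθ.1
  have hθ2 := hθ.2
  unfold Kc Kend
  refine ENNReal.add_ne_top.2 ⟨ENNReal.mul_ne_top (by simp) ?_, ENNReal.mul_ne_top (by simp) ?_⟩
  · exact sum0s (Real.exp_pos _) (by simpa using hθ1)
  · have := sum0 (r := Real.exp (-(1 - θ))) (Real.exp_pos _) (by simpa using hθ2)
    convert this using 4 with m
    rw [Real.exp_neg, inv_pow, zpow_neg, zpow_natCast]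

theorem finite_rep [CompleteSpace E] (hθ : θ ∈ Set.Ioo (0 : ℝ) 1)
    (h₀ : WS N₀ (Real.exp (-θ)) P₀) (h₁ : WS N₁ (Real.exp (1 - θ)) P₁)
    (hc₀ : ∀ n x, P₀ (cesaro ℂ n x) ≤ P₀ x) (hc₁ : ∀ n x, P₁ (cesaro ℂ n x) ≤ P₁ x)
    (x : ℤ → E) (v : E) (hx : HasSum x v) (hx₀ : P₀ x ≠ ∞) (hx₁ : P₁ x ≠ ∞)
    (hv₀ : N₀ v ≠ ∞) (hv₁ : N₁ v ≠ ∞) (ε : ℝ≥0∞) (hε : 0 < ε) :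
    ∃ d : ℤ → E, ∃ s : Finset ℤ, (∀ k ∉ s, d k = 0) ∧ ∑ k ∈ s, d k = v ∧
      P₀ d ≤ Kc θ * P₀ x + ε ∧ P₁ d ≤ Kc θ * P₁ x + ε := by
  have hθ1 := hθ.1
  have hθ2 := hθ.2
  have hsumm : Summable x := (summable_norm_of_ws hθ h₀ h₁ x hx₀ hx₁).of_norm
  have hsh : ∀ k : ℤ, HasSum (fun j => x (k + j)) v := fun k => by
    have := (Equiv.addLeft k).hasSum_iff.2 hx
    exact this
  set u : ℤ → E := fun k => ∑' m, x (k + eneg m) with hu_def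
  set w : ℤ → E := fun k => ∑' m : ℕ, x (k + m) with hw_def
  have hu : ∀ k, HasSum (fun m => x (k + eneg m)) (u k) := fun k => by
    have := (hsh k).summable.comp_injective (i := eneg) (fun a b h => by
      simp only [eneg] at h; omega)
    exact this.hasSum
  have hw : ∀ k, HasSum (fun m : ℕ => x (k + m)) (w k) := fun k => by
    have := (hsh k).summable.comp_injective (i := fun m : ℕ => (m : ℤ)) Nat.cast_injective
    exact this.hasSum
  have huw : ∀ k, u k + w k = v := fun k => by
    rw [add_comm]
    exact (HasSum.of_nat_of_neg_add_one (f := fun j => x (k + j)) (hw k) (hu k)).unique (hsh k)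
  have E0 := end_bound h₀ eneg (fun m => (m : ℤ) + 1) (fun a b h => by simpa using h)
    (sum0s (Real.exp_pos _) (by simpa using hθ1)) (sum0s' (Real.exp_pos _) (by simpa using hθ1))
    hc₀ x u hx₀ v hv₀ hu ε hε
  have E1 := end_bound h₁ (fun m => (m : ℤ)) (fun m => -(m : ℤ)) (fun a b h => by simpa using h)
    (by
      have := sum0 (r := Real.exp (-(1 - θ))) (Real.exp_pos _) (by simpa using hθ2)
      convert this using 4 with m
      rw [Real.exp_neg, inv_pow, zpow_neg, zpow_natCast])
    (by
      have := sum0' (r := Real.exp (-(1 - θ))) (Real.exp_pos _) (by simpa using hθ2)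
      convert this using 4 with m
      rw [Real.exp_neg, inv_pow, zpow_neg, zpow_natCast]
      simp)
    hc₁ x w hx₁ v hv₁ hw ε hε
  obtain ⟨n, hn0, hn1⟩ := (E0.and E1).exists
  set r0 : ℤ → E := fun k => if 0 < k then (1 - cw n k) • v else 0 with hr0
  set r1 : ℤ → E := fun k => if k ≤ 0 then (1 - cw n k) • v else 0 with hr1
  have B0 := hn0 r0 (fun m => by simp only [hr0]; rw [if_pos (by omega)]) (fun k hk => by
    simp only [hr0]; rw [if_neg]; intro h; apply hk; exact ⟨(k - 1).toNat, by simp only; omega⟩)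
  have B1 := hn1 r1 (fun m => by simp only [hr1]; rw [if_pos (by omega)]) (fun k hk => by
    simp only [hr1]; rw [if_neg]; intro h; apply hk; exact ⟨(-k).toNat, by simp only; omega⟩)
  set U := cesaro ℂ n u + r0 with hU
  set W := cesaro ℂ n w + r1 with hW
  have hUW : ∀ k, U k + W k = v := by
    intro k
    simp only [hU, hW, Pi.add_apply, cesaro_eq_cw, hr0, hr1]
    have := huw k
    rw [← this]
    split_ifs with h1 h2 h2
    · omega
    · module
    · module
    · omega
  have hUneg : ∀ k : ℤ, k ≤ -(n + 1) → U k = 0 := by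
    intro k hk
    simp only [hU, Pi.add_apply, cesaro_eq_cw, hr0]
    rw [cw_eq_zero (by rw [abs_of_nonpos (by omega)]; omega), if_neg (by omega)]; simp
  have hUpos : ∀ k : ℤ, (n + 1) ≤ k → U k = v := by
    intro k hk
    simp only [hU, Pi.add_apply, cesaro_eq_cw, hr0]
    rw [cw_eq_zero (by rw [abs_of_nonneg (by omega)]; omega), if_pos (by omega)]; simp
  refine ⟨fun k => U (k + 1) - U k, Finset.Ico (-(n + 1 : ℤ)) (-(n + 1 : ℤ) + (2 * (n + 1) : ℕ)),
    ?_, ?_, ?_, ?_⟩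
  · intro k hk
    simp only [Finset.mem_Ico, not_and_or, not_le, not_lt] at hk
    change U (k + 1) - U k = 0
    rcases hk with hk | hk
    · rw [hUneg k (by omega), hUneg (k + 1) (by omega), sub_zero]
    · rw [hUpos k (by push_cast at hk; omega), hUpos (k + 1) (by push_cast at hk; omega), sub_self]
  · rw [tele_int, hUpos _ (by push_cast; omega), hUneg _ le_rfl, sub_zero]
  · refine B0.trans ?_
    gcongr
    exact le_self_add
  · have e : (fun k => U (k + 1) - U k) = -(fun k => W (k + 1) - W k) := by
      ext k
      have e1 : U (k + 1) = v - W (k + 1) := eq_sub_of_add_eq (hUW _)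
      have e2 : U k = v - W k := eq_sub_of_add_eq (hUW _)
      simp only [Pi.neg_apply]
      rw [e1, e2]; abel
    rw [e]
    refine (h₁.neg _).trans (B1.trans ?_)
    gcongr
    exact le_add_self

/-- Finite representation with entries in the dense subspace. -/
theorem dense_rep [CompleteSpace E] (hθ : θ ∈ Set.Ioo (0 : ℝ) 1)
    (h₀ : WS N₀ (Real.exp (-θ)) P₀) (h₁ : WS N₁ (Real.exp (1 - θ)) P₁)
    (hc₀ : ∀ n x, P₀ (cesaro ℂ n x) ≤ P₀ x) (hc₁ : ∀ n x, P₁ (cesaro ℂ n x) ≤ P₁ x)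
    (D : Submodule ℂ E) (hD : ∀ w ∈ D, enInter N₀ N₁ w ≠ ∞)
    (hdense : ∀ v : E, enInter N₀ N₁ v ≠ ∞ → ∀ ε : ℝ≥0∞, 0 < ε →
          ∃ w ∈ D, enInter N₀ N₁ (v - w) < ε)
    (x : ℤ → E) (v : E) (hvD : v ∈ D) (hx : HasSum x v) (hx₀ : P₀ x ≠ ∞) (hx₁ : P₁ x ≠ ∞)
    (ε : ℝ≥0∞) (hε : 0 < ε) :
    ∃ d : ℤ → E, ∃ s : Finset ℤ, (∀ k ∉ s, d k = 0) ∧ (∀ k, d k ∈ D) ∧ ∑ k ∈ s, d k = v ∧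
      P₀ d ≤ Kc θ * P₀ x + ε ∧ P₁ d ≤ Kc θ * P₁ x + ε := by
  by_cases hεt : ε = ∞
  · refine ⟨fun k => if k = 0 then v else 0, {0}, ?_, ?_, ?_, ?_, ?_⟩
    · intro k hk; simp at hk; simp [hk]
    · intro k
      simp only
      split_ifs
      · exact hvD
      · exact D.zero_mem
    · simp
    · simp [hεt]
    · simp [hεt]
  have hNv := hD v hvD
  simp only [enInter, ne_eq, max_eq_top, not_or] at hNv
  obtain ⟨d, s, hds, hsum, hd0, hd1⟩ := finite_rep hθ h₀ h₁ hc₀ hc₁ x v hx hx₀ hx₁ hNv.1 hNv.2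
    (ε / 2) (by simpa using hε.ne')
  have hε2 : ε / 2 ≠ ∞ := ENNReal.div_ne_top hεt (by simp)
  have hd0t : P₀ d ≠ ∞ := ne_top_of_le_ne_top
    (ENNReal.add_ne_top.2 ⟨ENNReal.mul_ne_top (Kc_ne_top hθ) hx₀, hε2⟩) hd0
  have hd1t : P₁ d ≠ ∞ := ne_top_of_le_ne_top
    (ENNReal.add_ne_top.2 ⟨ENNReal.mul_ne_top (Kc_ne_top hθ) hx₁, hε2⟩) hd1
  set B : ℝ≥0∞ := 1 + ∑ k ∈ s, (ENNReal.ofReal (Real.exp (-θ) ^ k) +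
    ENNReal.ofReal (Real.exp (1 - θ) ^ k) + 1) with hB
  have hBt : B ≠ ∞ := by
    rw [hB]
    refine ENNReal.add_ne_top.2 ⟨by simp, ?_⟩
    rw [ne_eq, ENNReal.sum_eq_top]
    simp
  have hη : 0 < ε / 2 / B := ENNReal.div_pos (by simpa using hε.ne') hBt
  have hfin : ∀ k, enInter N₀ N₁ (d k) ≠ ∞ := by
    intro k
    simp only [enInter, ne_eq, max_eq_top, not_or]
    exact ⟨ne_top_of_le_ne_top (ENNReal.mul_ne_top (by simp) hd0t) (h₀.coord d k),
      ne_top_of_le_ne_top (ENNReal.mul_ne_top (by simp) hd1t) (h₁.coord d k)⟩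
  choose w hwD hw using fun k => hdense (d k) (hfin k) _ hη
  have hw0 : ∀ k, N₀ (d k - w k) ≤ ε / 2 / B := fun k => (le_max_left _ _).trans (hw k).le
  have hw1 : ∀ k, N₁ (d k - w k) ≤ ε / 2 / B := fun k => (le_max_right _ _).trans (hw k).le
  set c : ℤ → ℤ → E := fun i k => (if k = 0 then d i - w i else 0) +
    -(fun k => if k = i then d i - w i else 0) k with hcdef
  have hgen : ∀ {N : E → ℝ≥0∞} {a : ℝ} {P : (ℤ → E) → ℝ≥0∞}, WS N a P →
      (∀ k, N (d k - w k) ≤ ε / 2 / B) →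
      (∀ k : ℤ, ENNReal.ofReal (a ^ k) ≤ ENNReal.ofReal (Real.exp (-θ) ^ k) +
    ENNReal.ofReal (Real.exp (1 - θ) ^ k)) →
      P (∑ i ∈ s, c i) ≤ ε / 2 := by
    intro N a P h hN ha
    calc P (∑ i ∈ s, c i) ≤ ∑ i ∈ s, P (c i) := h.sum _ _
      _ ≤ ∑ i ∈ s, (ENNReal.ofReal (Real.exp (-θ) ^ i) +
          ENNReal.ofReal (Real.exp (1 - θ) ^ i) + 1) * (ε / 2 / B) := by
        refine Finset.sum_le_sum fun i _ => ?_
        refine (h.add_le _ _).trans ?_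
        rw [add_mul, add_comm]
        refine add_le_add ?_ ?_
        · refine (h.neg _).trans ((h.single _ _).trans ?_)
          exact mul_le_mul' (ha i) (hN i)
        · refine (h.single _ _).trans ?_
          exact mul_le_mul' (by simp) (hN i)
      _ ≤ B * (ε / 2 / B) := by
        rw [← Finset.sum_mul, hB]
        gcongr
        exact le_add_self
      _ ≤ ε / 2 := ENNReal.mul_div_le
  have hval : ∀ k, (d + ∑ i ∈ s, c i) k =
      (if k ∈ s then w k else 0) + if k = 0 then ∑ i ∈ s, (d i - w i) else 0 := by
    intro k
    simp only [Pi.add_apply, Finset.sum_apply, hcdef, Finset.sum_add_distrib,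
      Finset.sum_neg_distrib, Finset.sum_ite_eq]
    have : (∑ i ∈ s, if k = 0 then d i - w i else 0) =
      if k = 0 then ∑ i ∈ s, (d i - w i) else 0 := by split_ifs <;> simp
    rw [this]
    by_cases hk : k ∈ s
    · simp only [hk, if_true]; abel
    · simp only [hk, if_false, hds k hk]; abel
  refine ⟨d + ∑ i ∈ s, c i, insert 0 s, ?_, ?_, ?_, ?_, ?_⟩
  · intro k hk
    rw [Finset.mem_insert, not_or] at hk
    rw [hval, if_neg hk.1, if_neg hk.2, add_zero]
  · intro k
    rw [hval]
    refine D.add_mem ?_ ?_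
    · split_ifs
      · exact hwD k
      · exact D.zero_mem
    · split_ifs
      · rw [Finset.sum_sub_distrib, hsum]
        exact D.sub_mem hvD (D.sum_mem fun i _ => hwD i)
      · exact D.zero_mem
  · simp only [hval]
    rw [Finset.sum_add_distrib, Finset.sum_ite_eq', if_pos (Finset.mem_insert_self _ _),
      ← Finset.sum_subset (Finset.subset_insert 0 s) (fun k _ hk => if_neg hk),
      Finset.sum_congr rfl (fun k hk => if_pos hk), Finset.sum_sub_distrib, hsum]
    abel
  · refine (h₀.add_le _ _).trans ((add_le_add hd0 (hgen h₀ hw0 fun k => le_self_add)).trans ?_)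
    rw [add_assoc, ENNReal.add_halves]
  · refine (h₁.add_le _ _).trans ((add_le_add hd1 (hgen h₁ hw1 fun k => le_add_self)).trans ?_)
    rw [add_assoc, ENNReal.add_halves]

end


section
variable {F : Type*} [NormedAddCommGroup F] [NormedSpace ℂ F]

theorem cont_line {f : ℂ → F} (hc : ContinuousOn f closedStrip) {σ : ℝ} (h0 : 0 ≤ σ) (h1 : σ ≤ 1) :
    Continuous (fun t : ℝ => f ((σ : ℂ) + (t : ℂ) * Complex.I)) := by
  rw [← continuousOn_univ]
  refine hc.comp (by fun_prop) ?_
  intro t _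
  simp [closedStrip, h0, h1]

theorem exp_per (k : ℤ) (z : ℂ) :
    Complex.exp (k * (z + 2 * (Real.pi : ℂ) * Complex.I)) = Complex.exp (k * z) := by
  rw [mul_add, Complex.exp_add, Complex.exp_int_mul_two_pi_mul_I, mul_one]

theorem fourier_shift {f : ℂ → F} (hc : ContinuousOn f closedStrip)
    (hd : ∀ z ∈ openStrip, DifferentiableAt ℂ f z)
    (hp : ∀ z ∈ closedStrip, f (z + 2 * (Real.pi : ℂ) * Complex.I) = f z)
    {σ : ℝ} (h0 : 0 ≤ σ) (h1 : σ ≤ 1) (k : ℤ) :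
    fourierCoef f σ k = Complex.exp (k * σ) • fourierCoef f 0 k := by
  set g : ℂ → F := fun z => Complex.exp (((-k : ℤ) : ℂ) * z) • f z with hg
  have hgc : ContinuousOn g closedStrip := by
    refine ContinuousOn.smul (by fun_prop) hc
  have hgd : ∀ z ∈ openStrip, DifferentiableAt ℂ g z := by
    intro z hz
    exact DifferentiableAt.smul (by fun_prop) (hd z hz)
  have hgp : ∀ z ∈ closedStrip, g (z + 2 * (Real.pi : ℂ) * Complex.I) = g z := by
    intro z hz
    simp only [hg]
    rw [hp z hz, exp_per]
  have hrect := Complex.integral_boundary_rect_eq_zero_of_continuousOn_of_differentiableOn g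
    ((0 : ℂ) + (-Real.pi : ℝ) * Complex.I) ((σ : ℂ) + (Real.pi : ℝ) * Complex.I)
    (hgc.mono (by
      intro z hz
      rw [Complex.mem_reProdIm] at hz
      have := hz.1
      simp [Set.uIcc_of_le h0] at this
      exact ⟨this.1, this.2.trans h1⟩))
    (by
      intro z hz
      rw [Complex.mem_reProdIm] at hz
      have := hz.1
      simp [h0] at this
      exact (hgd z ⟨this.1, this.2.trans_le h1⟩).differentiableWithinAt)
  have e1 : (∫ (x : ℝ) in (0:ℝ)..σ, g (x + (Real.pi : ℂ) * Complex.I)) =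
      ∫ (x : ℝ) in (0:ℝ)..σ, g (x + ((-Real.pi : ℝ) : ℂ) * Complex.I) := by
    apply intervalIntegral.integral_congr
    intro x hx
    rw [Set.uIcc_of_le h0] at hx
    simp only
    rw [← hgp ((x : ℂ) + ((-Real.pi : ℝ) : ℂ) * Complex.I)]
    · congr 1; push_cast; ring
    · simp [closedStrip, hx.1, hx.2.trans h1]
  simp only [Complex.add_re, Complex.add_im, Complex.mul_re, Complex.mul_im, Complex.ofReal_re,
    Complex.ofReal_im, Complex.I_re, Complex.I_im, Complex.zero_re, Complex.zero_im] at hrect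
  simp only [mul_zero, mul_one, zero_mul, sub_zero, add_zero, zero_add] at hrect
  rw [e1, sub_self, zero_add, ← smul_sub, smul_eq_zero] at hrect
  have hrect := hrect.resolve_left Complex.I_ne_zero
  rw [sub_eq_zero] at hrect
  unfold fourierCoef
  rw [smul_comm]
  congr 1
  have e2 : (∫ t in (-Real.pi)..Real.pi,
    Complex.exp (-(k : ℂ) * Complex.I * (t : ℂ)) • f (((0 : ℝ) : ℂ) + (t : ℂ) * Complex.I)) =
    ∫ t in (-Real.pi)..Real.pi, g (((0 : ℝ) : ℂ) + (t : ℂ) * Complex.I) := by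
    apply intervalIntegral.integral_congr
    intro t _
    simp only [hg]
    congr 2; push_cast; ring
  rw [e2, ← hrect, ← intervalIntegral.integral_smul]
  apply intervalIntegral.integral_congr
  intro t _
  simp only [hg, smul_smul]
  rw [← Complex.exp_add]
  congr 2; push_cast; ring

theorem fourier_inv_scalar (g : ℝ → ℂ) (hg : Continuous g) (hp : Function.Periodic g (2 * Real.pi))
    (hs : Summable fun k : ℤ => (2 * (Real.pi : ℂ))⁻¹ • ∫ t in (-Real.pi)..Real.pi,
      Complex.exp (-(k : ℂ) * Complex.I * (t : ℂ)) • g t) :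
    HasSum (fun k : ℤ => (2 * (Real.pi : ℂ))⁻¹ • ∫ t in (-Real.pi)..Real.pi,
      Complex.exp (-(k : ℂ) * Complex.I * (t : ℂ)) • g t) (g 0) := by
  have : Fact (0 < 2 * Real.pi) := ⟨by positivity⟩
  have hpi : (Real.pi : ℂ) ≠ 0 := by exact_mod_cast Real.pi_ne_zero
  let G : C(AddCircle (2 * Real.pi), ℂ) := ⟨hp.lift, by
    exact Continuous.quotient_liftOn' hg _⟩
  have hG : ∀ t : ℝ, G (t : AddCircle (2 * Real.pi)) = g t := fun t => hp.lift_coe t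
  have hco : ∀ k : ℤ, fourierCoeff G k = (2 * (Real.pi : ℂ))⁻¹ • ∫ t in (-Real.pi)..Real.pi,
      Complex.exp (-(k : ℂ) * Complex.I * (t : ℂ)) • g t := by
    intro k
    rw [fourierCoeff_eq_intervalIntegral _ k (-Real.pi)]
    have : -Real.pi + 2 * Real.pi = Real.pi := by ring
    rw [this, ← Complex.coe_smul]
    congr 1
    · push_cast; simp
    · apply intervalIntegral.integral_congr
      intro t _
      simp only [hG]
      rw [fourier_coe_apply]
      congr 2
      push_cast
      field_simp
  have h := has_pointwise_sum_fourier_series_of_summable (f := G)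
    (by rw [show (fourierCoeff G) = _ from funext hco]; exact hs) ((0 : ℝ) : AddCircle (2 * Real.pi))
  rw [hG] at h
  simpa [hco] using h

theorem fourier_inv [CompleteSpace F] {f : ℂ → F} (hc : ContinuousOn f closedStrip)
    (hp : ∀ z ∈ closedStrip, f (z + 2 * (Real.pi : ℂ) * Complex.I) = f z)
    {σ : ℝ} (h0 : 0 ≤ σ) (h1 : σ ≤ 1) (hs : Summable (fun k => fourierCoef f σ k)) :
    HasSum (fun k => fourierCoef f σ k) (f σ) := by
  have hcl := cont_line hc h0 h1
  have key : ∀ φ : StrongDual ℂ F, φ (∑' k, fourierCoef f σ k) = φ (f σ) := by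
    intro φ
    have hφ : ∀ k, φ (fourierCoef f σ k) = (2 * (Real.pi : ℂ))⁻¹ • ∫ t in (-Real.pi)..Real.pi,
      Complex.exp (-(k : ℂ) * Complex.I * (t : ℂ)) • φ (f ((σ : ℂ) + (t : ℂ) * Complex.I)) := by
      intro k
      unfold fourierCoef
      rw [map_smul, ← ContinuousLinearMap.intervalIntegral_comp_comm]
      · simp only [map_smul]
      · apply Continuous.intervalIntegrable
        exact Continuous.smul (by fun_prop) hcl
    have hsφ : HasSum (fun k => φ (fourierCoef f σ k)) (φ (∑' k, fourierCoef f σ k)) :=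
      φ.hasSum hs.hasSum
    have h2 := fourier_inv_scalar (fun t => φ (f ((σ : ℂ) + (t : ℂ) * Complex.I)))
      (φ.continuous.comp hcl) (by
        intro t
        simp only
        rw [← hp ((σ : ℂ) + (t : ℂ) * Complex.I) (by simp [closedStrip, h0, h1])]
        congr 2; push_cast; ring) (by
        have := hsφ.summable
        simpa only [hφ] using this)
    simp only [hφ] at hsφ
    have h3 := hsφ.unique h2
    simpa [hφ] using h3
  have := (SeparatingDual.eq_iff_forall_dual_eq (R := ℂ)).2 key
  rw [← this]
  exact hs.hasSum

theorem strip_rep [CompleteSpace F] {θ : ℝ} (hθ : θ ∈ Set.Ioo (0 : ℝ) 1)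
    {M₀ M₁ : F → ℝ≥0∞} {T₀ T₁ : (ℤ → F) → ℝ≥0∞}
    (h₀ : WS M₀ (Real.exp (-θ)) (wtSeq (Real.exp (-θ)) T₀))
    (h₁ : WS M₁ (Real.exp (1 - θ)) (wtSeq (Real.exp (1 - θ)) T₁))
    {f : ℂ → F} (hc : ContinuousOn f closedStrip)
    (hd : ∀ z ∈ openStrip, DifferentiableAt ℂ f z)
    (hp : ∀ z ∈ closedStrip, f (z + 2 * (Real.pi : ℂ) * Complex.I) = f z)
    (B₀ : T₀ (fun k => fourierCoef f 0 k) ≠ ∞) (B₁ : T₁ (fun k => fourierCoef f 1 k) ≠ ∞) :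
    JN (wtSeq (Real.exp (-θ)) T₀) (wtSeq (Real.exp (1 - θ)) T₁) (f θ) ≤
      max (T₀ (fun k => fourierCoef f 0 k)) (T₁ (fun k => fourierCoef f 1 k)) := by
  have e0 : wtSeq (Real.exp (-θ)) T₀ (fun k => fourierCoef f θ k) =
      T₀ (fun k => fourierCoef f 0 k) := by
    unfold wtSeq
    congr 1; ext k
    simp only
    rw [fourier_shift hc hd hp hθ.1.le hθ.2.le, exp_zpow', ← Complex.coe_smul, smul_smul,
      Complex.ofReal_exp, ← Complex.exp_add]
    push_cast
    rw [show -(θ : ℂ) * k + k * θ = 0 by ring]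
    simp
  have e1 : wtSeq (Real.exp (1 - θ)) T₁ (fun k => fourierCoef f θ k) =
      T₁ (fun k => fourierCoef f 1 k) := by
    unfold wtSeq
    congr 1; ext k
    simp only
    rw [fourier_shift hc hd hp hθ.1.le hθ.2.le, fourier_shift hc hd hp zero_le_one le_rfl,
      exp_zpow', ← Complex.coe_smul, smul_smul,
      Complex.ofReal_exp, ← Complex.exp_add]
    congr 2
    push_cast
    ring
  have hsum : Summable (fun k => fourierCoef f θ k) :=
    (summable_norm_of_ws hθ h₀ h₁ _ (by rw [e0]; exact B₀) (by rw [e1]; exact B₁)).of_norm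
  have := JN_le (P₀ := wtSeq (Real.exp (-θ)) T₀) (P₁ := wtSeq (Real.exp (1 - θ)) T₁)
    (fourier_inv hc hp hθ.1.le hθ.2.le hsum)
  rwa [e0, e1] at this
end

theorem stein_core {E F : Type*} [NormedAddCommGroup E] [NormedSpace ℂ E]
    [NormedAddCommGroup F] [NormedSpace ℂ F] [CompleteSpace F] {θ : ℝ}
    (hθ : θ ∈ Set.Ioo (0 : ℝ) 1)
    {M₀ M₁ : F → ℝ≥0∞} {T₀ T₁ : (ℤ → F) → ℝ≥0∞} {S₀ S₁ : (ℤ → E) → ℝ≥0∞}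
    (h₀ : WS M₀ (Real.exp (-θ)) (wtSeq (Real.exp (-θ)) T₀))
    (h₁ : WS M₁ (Real.exp (1 - θ)) (wtSeq (Real.exp (1 - θ)) T₁))
    (D : Submodule ℂ E) (T : ℂ → E →ₗ[ℂ] F)
    (hTc : ∀ x ∈ D, ContinuousOn (fun z => T z x) closedStrip)
    (hTd : ∀ x ∈ D, ∀ z ∈ openStrip, DifferentiableAt ℂ (fun z => T z x) z)
    (hTp : ∀ x ∈ D, ∀ z ∈ closedStrip, T (z + 2 * (Real.pi : ℂ) * Complex.I) x = T z x)
    (Mc₀ Mc₁ : ℝ≥0∞) (hMc₀ : Mc₀ ≠ ∞) (hMc₁ : Mc₁ ≠ ∞)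
    (hb₀ : ∀ x : ℤ → E, (Function.support x).Finite → (∀ k, x k ∈ D) →
          T₀ (fun k' : ℤ => (2 * (Real.pi : ℂ))⁻¹ •
              ∫ t in (-Real.pi)..Real.pi,
                Complex.exp (-(k' : ℂ) * Complex.I * (t : ℂ)) •
                  (∑ᶠ k : ℤ, Complex.exp ((k : ℂ) * Complex.I * (t : ℂ)) •
                    T ((0 : ℂ) + (t : ℂ) * Complex.I) (x k))) ≤
            Mc₀ * S₀ x)
    (hb₁ : ∀ x : ℤ → E, (Function.support x).Finite → (∀ k, x k ∈ D) →
          T₁ (fun k' : ℤ => (2 * (Real.pi : ℂ))⁻¹ •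
              ∫ t in (-Real.pi)..Real.pi,
                Complex.exp (-(k' : ℂ) * Complex.I * (t : ℂ)) •
                  (∑ᶠ k : ℤ, Complex.exp ((k : ℂ) * Complex.I * (t : ℂ)) •
                    T ((1 : ℂ) + (t : ℂ) * Complex.I) (x k))) ≤
            Mc₁ * S₁ x)
    (x : ℤ → E) (s : Finset ℤ) (hxs : ∀ k ∉ s, x k = 0) (hxD : ∀ k, x k ∈ D)
    (hx₀ : wtSeq (Real.exp (-θ)) S₀ x ≠ ∞) (hx₁ : wtSeq (Real.exp (1 - θ)) S₁ x ≠ ∞) :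
    JN (wtSeq (Real.exp (-θ)) T₀) (wtSeq (Real.exp (1 - θ)) T₁) (T θ (∑ k ∈ s, x k)) ≤
      max (Mc₀ * wtSeq (Real.exp (-θ)) S₀ x) (Mc₁ * wtSeq (Real.exp (1 - θ)) S₁ x) := by
  set f : ℂ → F := fun z => ∑ k ∈ s, Complex.exp (k * (z - θ)) • T z (x k) with hf
  have hc : ContinuousOn f closedStrip := by
    refine continuousOn_finsetSum _ fun k _ => ?_
    exact ContinuousOn.smul (by fun_prop) (hTc _ (hxD k))
  have hd : ∀ z ∈ openStrip, DifferentiableAt ℂ f z := by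
    intro z hz
    refine DifferentiableAt.fun_sum fun k _ => ?_
    exact DifferentiableAt.smul (by fun_prop) (hTd _ (hxD k) z hz)
  have hp : ∀ z ∈ closedStrip, f (z + 2 * (Real.pi : ℂ) * Complex.I) = f z := by
    intro z hz
    refine Finset.sum_congr rfl fun k _ => ?_
    rw [hTp _ (hxD k) z hz, add_sub_right_comm, exp_per]
  have hfθ : f θ = T θ (∑ k ∈ s, x k) := by
    simp [hf]
  have hgen : ∀ j : ℝ, (fun k' : ℤ => (2 * (Real.pi : ℂ))⁻¹ •
              ∫ t in (-Real.pi)..Real.pi,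
                Complex.exp (-(k' : ℂ) * Complex.I * (t : ℂ)) •
                  (∑ᶠ k : ℤ, Complex.exp ((k : ℂ) * Complex.I * (t : ℂ)) •
                    T ((j : ℂ) + (t : ℂ) * Complex.I) (Real.exp (j - θ) ^ k • x k))) =
        fun k' => fourierCoef f j k' := by
    intro j
    ext k'
    unfold fourierCoef
    congr 1
    apply intervalIntegral.integral_congr
    intro t _
    simp only
    congr 1
    rw [finsum_eq_sum_of_support_subset (s := s)]
    · refine Finset.sum_congr rfl fun k _ => ?_
      rw [exp_zpow', ← Complex.coe_smul, map_smul, smul_smul, Complex.ofReal_exp, ← Complex.exp_add]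
      congr 2
      push_cast; ring
    · intro k hk
      by_contra hks
      apply hk
      simp [hxs k hks]
  have hsupp : ∀ a : ℝ, (Function.support fun k : ℤ => a ^ k • x k).Finite := by
    intro a
    refine s.finite_toSet.subset ?_
    intro k hk
    by_contra hks
    apply hk
    simp [hxs k hks]
  have hmem : ∀ a : ℝ, ∀ k : ℤ, a ^ k • x k ∈ D := by
    intro a k
    rw [← Complex.coe_smul]
    exact D.smul_mem _ (hxD k)
  have b0 : T₀ (fun k => fourierCoef f 0 k) ≤ Mc₀ * wtSeq (Real.exp (-θ)) S₀ x := by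
    have := hb₀ (fun k => Real.exp (-θ) ^ k • x k) (hsupp _) (hmem _)
    rw [← hgen 0]
    simpa [wtSeq] using this
  have b1 : T₁ (fun k => fourierCoef f 1 k) ≤ Mc₁ * wtSeq (Real.exp (1 - θ)) S₁ x := by
    have := hb₁ (fun k => Real.exp (1 - θ) ^ k • x k) (hsupp _) (hmem _)
    rw [← hgen 1]
    simpa [wtSeq] using this
  rw [← hfθ]
  exact (strip_rep hθ h₀ h₁ hc hd hp (ne_top_of_le_ne_top (ENNReal.mul_ne_top hMc₀ hx₀) b0)
    (ne_top_of_le_ne_top (ENNReal.mul_ne_top hMc₁ hx₁) b1)).trans (max_le_max b0 b1)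


theorem const_choice {θ : ℝ} (hθ : θ ∈ Set.Ioo (0 : ℝ) 1) (Mc₀ Mc₁ : ℝ≥0∞) (h0 : 0 < Mc₀)
    (h0' : Mc₀ ≠ ∞) (h1 : 0 < Mc₁) (h1' : Mc₁ ≠ ∞) :
    ∃ n : ℤ, Mc₀ * ENNReal.ofReal (Real.exp (θ * n)) ≤
        ENNReal.ofReal (Real.exp (1 - θ)) * Mc₀ ^ (1 - θ) * Mc₁ ^ θ ∧
      Mc₁ * ENNReal.ofReal (Real.exp (-(1 - θ) * n)) ≤
        ENNReal.ofReal (Real.exp (1 - θ)) * Mc₀ ^ (1 - θ) * Mc₁ ^ θ := by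
  have hex : ∀ M : ℝ≥0∞, 0 < M → M ≠ ∞ → ∃ p : ℝ, M = ENNReal.ofReal (Real.exp p) := by
    intro M hM hM'
    refine ⟨Real.log M.toReal, ?_⟩
    rw [Real.exp_log (ENNReal.toReal_pos hM.ne' hM'), ENNReal.ofReal_toReal hM']
  obtain ⟨p, rfl⟩ := hex Mc₀ h0 h0'
  obtain ⟨q, rfl⟩ := hex Mc₁ h1 h1'
  have hθ1 := hθ.1
  have hθ2 := hθ.2
  have e1 := Int.floor_le (q - p)
  have e2 := Int.lt_floor_add_one (q - p)
  refine ⟨⌊q - p⌋, ?_, ?_⟩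
  all_goals
    rw [ENNReal.ofReal_rpow_of_pos (Real.exp_pos _), ENNReal.ofReal_rpow_of_pos (Real.exp_pos _),
      ← Real.exp_mul, ← Real.exp_mul, ← ENNReal.ofReal_mul (Real.exp_pos _).le,
      ← ENNReal.ofReal_mul (Real.exp_pos _).le, ← ENNReal.ofReal_mul (by positivity),
      ← Real.exp_add, ← Real.exp_add, ← Real.exp_add]
    apply ENNReal.ofReal_le_ofReal
    apply Real.exp_le_exp.2
    nlinarith

theorem small_exp {c : ℝ} (hc : 0 < c) {B ε : ℝ≥0∞} (hB : B ≠ ∞) (hε : 0 < ε) :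
    ∃ m : ℕ, ENNReal.ofReal (Real.exp (-c * m)) * B < ε := by
  have h1 : Tendsto (fun m : ℕ => Real.exp (-c * m)) atTop (𝓝 0) := by
    refine Real.tendsto_exp_atBot.comp ?_
    exact (tendsto_natCast_atTop_atTop (R := ℝ)).const_mul_atTop_of_neg (by linarith)
  have h2 := ENNReal.tendsto_ofReal h1
  have h3 := ENNReal.Tendsto.mul_const h2 (b := B) (Or.inr hB)
  simp only [ENNReal.ofReal_zero, zero_mul] at h3
  exact ((tendsto_order.1 h3).2 ε hε).exists

theorem extend_lemma {E F : Type*} [NormedAddCommGroup E] [NormedSpace ℂ E]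
    [NormedAddCommGroup F] [NormedSpace ℂ F] [CompleteSpace F]
    (D : Submodule ℂ E) (A : E →ₗ[ℂ] F) (JP : E → ℝ≥0∞) (JQ : F → ℝ≥0∞) (L C : ℝ≥0∞)
    (hL : L ≠ ∞) (hC : C ≠ ∞) (hC0 : C ≠ 0)
    (Pz : JP 0 = 0)
    (Padd : ∀ v w, JP (v + w) ≤ JP v + JP w) (Psmul : ∀ (c : ℂ) v, JP (c • v) ≤ ‖c‖ₑ * JP v)
    (PD : ∀ v ∈ D, JP v ≠ ∞)
    (Qn : ∀ w, ‖w‖ₑ ≤ L * JQ w)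
    (Qt : ∀ (y : ℕ → F) (v : F), HasSum y v → JQ v ≤ ∑' n, JQ (y n))
    (hA : ∀ x ∈ D, JQ (A x) ≤ C * JP x)
    (dense : ∀ v, JP v ≠ ∞ → ∀ ε : ℝ≥0∞, 0 < ε → ∃ d ∈ D, JP (v - d) < ε) :
    ∃ Tb : E → F, (∀ x ∈ D, Tb x = A x) ∧
      (∀ v w : E, JP v ≠ ∞ → JP w ≠ ∞ → Tb (v + w) = Tb v + Tb w) ∧
      (∀ (c : ℂ) (v : E), JP v ≠ ∞ → Tb (c • v) = c • Tb v) ∧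
      (∀ v : E, JQ (Tb v) ≤ C * JP v) := by
  classical
  have Pneg : ∀ v, JP (-v) ≤ JP v := fun v => by simpa using Psmul (-1) v
  set R : E → F → Prop := fun v y => ∀ ε : ℝ≥0∞, 0 < ε → ∃ d ∈ D, JP (v - d) < ε ∧ ‖y - A d‖ₑ < ε
    with hR
  have R0 : ∀ y, R 0 y → y = 0 := by
    intro y hy
    have hb : ∀ ε : ℝ≥0∞, 0 < ε → ‖y‖ₑ ≤ (1 + L * C) * ε := by
      intro ε hε
      obtain ⟨d, hdD, hd1, hd2⟩ := hy ε hε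
      rw [zero_sub] at hd1
      have hd : JP d ≤ ε := by
        have := Pneg (-d)
        rw [neg_neg] at this
        exact this.trans hd1.le
      calc ‖y‖ₑ = ‖(y - A d) + A d‖ₑ := by rw [sub_add_cancel]
        _ ≤ ‖y - A d‖ₑ + ‖A d‖ₑ := enorm_add_le _ _
        _ ≤ ε + L * (C * ε) := by
          refine add_le_add hd2.le ((Qn _).trans ?_)
          gcongr
          exact (hA d hdD).trans (by gcongr)
        _ = _ := by ring
    have h1 : (1 + L * C) ≠ ∞ := by simp [ENNReal.mul_ne_top hL hC]
    have : ‖y‖ₑ ≤ 0 := by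
      refine ENNReal.le_of_forall_pos_le_add fun ε hε _ => ?_
      have := hb (ε / (1 + L * C)) (ENNReal.div_pos (by simpa using hε.ne') h1)
      rw [zero_add]
      exact this.trans ENNReal.mul_div_le
    simpa using this
  have Radd : ∀ v w y z, R v y → R w z → R (v + w) (y + z) := by
    intro v w y z hy hz ε hε
    have hε2 : 0 < ε / 2 := by simpa using hε.ne'
    obtain ⟨d, hdD, hd1, hd2⟩ := hy _ hε2
    obtain ⟨d', hdD', hd1', hd2'⟩ := hz _ hε2
    refine ⟨d + d', D.add_mem hdD hdD', ?_, ?_⟩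
    · rw [add_sub_add_comm, ← ENNReal.add_halves ε]
      exact (Padd _ _).trans_lt (ENNReal.add_lt_add hd1 hd1')
    · rw [map_add, add_sub_add_comm, ← ENNReal.add_halves ε]
      exact (enorm_add_le _ _).trans_lt (ENNReal.add_lt_add hd2 hd2')
  have RD : ∀ x ∈ D, R x (A x) := by
    intro x hx ε hε
    exact ⟨x, hx, by simpa [Pz] using hε, by simpa using hε⟩
  have Rsmul : ∀ (c : ℂ) v y, R v y → R (c • v) (c • y) := by
    intro c v y hy
    by_cases hc : c = 0
    · subst hc
      simpa using RD 0 D.zero_mem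
    intro ε hε
    have hc0 : ‖c‖ₑ ≠ 0 := by simpa using hc
    have hct : ‖c‖ₑ ≠ ∞ := enorm_ne_top
    obtain ⟨d, hdD, hd1, hd2⟩ := hy (ε / ‖c‖ₑ) (ENNReal.div_pos hε.ne' hct)
    have hmul : ∀ a, a < ε / ‖c‖ₑ → ‖c‖ₑ * a < ε := by
      intro a ha
      rw [mul_comm]
      exact (ENNReal.lt_div_iff_mul_lt (Or.inl hc0) (Or.inl hct)).1 ha
    refine ⟨c • d, D.smul_mem c hdD, ?_, ?_⟩
    · rw [← smul_sub]
      exact (Psmul _ _).trans_lt (hmul _ hd1)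
    · rw [map_smul, ← smul_sub, enorm_smul]
      exact hmul _ hd2
  have Runiq : ∀ v y z, R v y → R v z → y = z := by
    intro v y z hy hz
    have := Radd _ _ _ _ hy (Rsmul (-1) _ _ hz)
    simp only [neg_smul, one_smul, add_neg_cancel] at this
    have := R0 _ this
    rwa [← sub_eq_add_neg, sub_eq_zero] at this
  have Rex : ∀ v, JP v ≠ ∞ → ∀ η : ℝ≥0∞, 0 < η → η ≠ ∞ →
      ∃ y, R v y ∧ JQ y ≤ C * (JP v + 5 * η) := by
    intro v hv η hη hηt
    set δ : ℕ → ℝ≥0∞ := fun n => η * 2⁻¹ ^ n with hδ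
    have hδpos : ∀ n, 0 < δ n := fun n => by
      simp only [hδ]
      exact ENNReal.mul_pos hη.ne' (ENNReal.pow_pos (by simp) n).ne'
    have hδsum : ∑' n, δ n = η * 2 := by
      rw [ENNReal.tsum_mul_left, ENNReal.tsum_geometric_two]
    have hδt : Tendsto δ atTop (𝓝 0) :=
      ENNReal.tendsto_atTop_zero_of_tsum_ne_top (by rw [hδsum]; exact ENNReal.mul_ne_top hηt (by simp))
    have hδs : ∀ n, δ (n + 1) ≤ δ n := fun n => by
      simp only [hδ, pow_succ]
      gcongr
      exact mul_le_of_le_one_right' (by simp)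
    choose d hdD hd using fun n => dense v hv (δ n) (hδpos n)
    set z : ℕ → F := fun n => Nat.casesOn n (A (d 0)) (fun m => A (d (m + 1) - d m)) with hz
    have hz0 : JQ (z 0) ≤ C * (JP v + η) := by
      refine (hA _ (hdD 0)).trans ?_
      gcongr
      have e : d 0 = v + -(v - d 0) := by abel
      calc JP (d 0) = JP (v + -(v - d 0)) := by rw [← e]
        _ ≤ _ := (Padd _ _).trans (add_le_add le_rfl ((Pneg _).trans ?_))
      have := (hd 0).le
      simpa [hδ] using this
    have hzs : ∀ m, JQ (z (m + 1)) ≤ C * (2 * δ m) := by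
      intro m
      refine (hA _ (D.sub_mem (hdD _) (hdD _))).trans ?_
      gcongr
      have e : d (m + 1) - d m = (v - d m) + -(v - d (m + 1)) := by abel
      rw [e, two_mul]
      exact (Padd _ _).trans (add_le_add (hd m).le
        ((Pneg _).trans ((hd _).le.trans (hδs m))))
    have htot : ∑' n, JQ (z n) ≤ C * (JP v + 5 * η) := by
      rw [tsum_eq_zero_add' ENNReal.summable]
      calc _ ≤ C * (JP v + η) + ∑' m, C * (2 * δ m) :=
            add_le_add hz0 (ENNReal.tsum_le_tsum hzs)
        _ = _ := by
            rw [ENNReal.tsum_mul_left, ENNReal.tsum_mul_left, hδsum]; ring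
    have htott : ∑' n, JQ (z n) ≠ ∞ := ne_top_of_le_ne_top
      (ENNReal.mul_ne_top hC (ENNReal.add_ne_top.2 ⟨hv, ENNReal.mul_ne_top (by simp) hηt⟩)) htot
    have hsn : ∑' n, ‖z n‖ₑ ≠ ∞ := by
      refine ne_top_of_le_ne_top (ENNReal.mul_ne_top hL htott) ?_
      rw [← ENNReal.tsum_mul_left]
      exact ENNReal.tsum_le_tsum fun n => Qn _
    have hsum : Summable z := by
      have h3 := ENNReal.summable_toReal hsn
      simp only [toReal_enorm] at h3
      exact h3.of_norm
    have hpart : ∀ n, ∑ i ∈ Finset.range (n + 1), z i = A (d n) := by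
      intro n
      induction n with
      | zero => simp [hz]
      | succ n ih =>
        rw [Finset.sum_range_succ, ih]
        simp [hz]
    have hlim : Tendsto (fun n => A (d n)) atTop (𝓝 (∑' n, z n)) := by
      have := (tendsto_add_atTop_iff_nat 1).2 hsum.hasSum.tendsto_sum_nat
      simpa only [hpart] using this
    refine ⟨∑' n, z n, ?_, (Qt z _ hsum.hasSum).trans htot⟩
    intro ε hε
    have hl2 : Tendsto (fun n => ‖(∑' n, z n) - A (d n)‖ₑ) atTop (𝓝 0) := by
      rw [tendsto_iff_edist_tendsto_0] at hlim
      refine hlim.congr fun n => ?_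
      rw [edist_comm, edist_eq_enorm_sub]
    obtain ⟨n, hn1, hn2⟩ := (((tendsto_order.1 hδt).2 ε hε).and ((tendsto_order.1 hl2).2 ε hε)).exists
    exact ⟨d n, hdD n, (hd n).trans hn1, hn2⟩
  have Rex' : ∀ v, ∃ y, JP v ≠ ∞ → R v y := by
    intro v
    by_cases hv : JP v = ∞
    · exact ⟨0, fun h => absurd hv h⟩
    · obtain ⟨y, hy, _⟩ := Rex v hv 1 (by simp) (by simp)
      exact ⟨y, fun _ => hy⟩
  choose Tb hTb using Rex'
  refine ⟨Tb, ?_, ?_, ?_, ?_⟩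
  · intro x hx
    exact Runiq x _ _ (hTb x (PD x hx)) (RD x hx)
  · intro v w hv hw
    exact Runiq _ _ _ (hTb (v + w) (ne_top_of_le_ne_top (ENNReal.add_ne_top.2 ⟨hv, hw⟩) (Padd v w)))
      (Radd _ _ _ _ (hTb v hv) (hTb w hw))
  · intro c v hv
    exact Runiq _ _ _ (hTb (c • v) (ne_top_of_le_ne_top (ENNReal.mul_ne_top enorm_ne_top hv)
      (Psmul c v))) (Rsmul c _ _ (hTb v hv))
  · intro v
    by_cases hv : JP v = ∞
    · rw [hv, ENNReal.mul_top hC0]; exact le_top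
    refine ENNReal.le_of_forall_pos_le_add fun ε hε _ => ?_
    have h5 : (5 * C : ℝ≥0∞) ≠ ∞ := ENNReal.mul_ne_top (by simp) hC
    have h50 : (5 * C : ℝ≥0∞) ≠ 0 := mul_ne_zero (by simp) hC0
    obtain ⟨y, hy, hy'⟩ := Rex v hv (ε / (5 * C)) (ENNReal.div_pos (by simpa using hε.ne') h5)
      (ENNReal.div_ne_top (by simp) h50)
    rw [Runiq v _ _ (hTb v hv) hy]
    refine hy'.trans ?_
    rw [mul_add]
    gcongr
    calc C * (5 * (ε / (5 * C))) = (5 * C) * (ε / (5 * C)) := by ring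
      _ ≤ _ := ENNReal.mul_div_le

section
variable {E : Type*} [NormedAddCommGroup E] [NormedSpace ℂ E] {θ : ℝ}
  {N₀ N₁ : E → ℝ≥0∞} {P₀ P₁ : (ℤ → E) → ℝ≥0∞}

theorem dense_JN (hθ : θ ∈ Set.Ioo (0 : ℝ) 1)
    (h₀ : WS N₀ (Real.exp (-θ)) P₀) (h₁ : WS N₁ (Real.exp (1 - θ)) P₁)
    (hc₀ : ∀ n x, P₀ (cesaro ℂ n x) ≤ P₀ x) (hc₁ : ∀ n x, P₁ (cesaro ℂ n x) ≤ P₁ x)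
    (hlim : (∀ x, P₀ x ≠ ∞ → Tendsto (fun n => P₀ (cesaro ℂ n x - x)) atTop (𝓝 0)) ∨
      (∀ x, P₁ x ≠ ∞ → Tendsto (fun n => P₁ (cesaro ℂ n x - x)) atTop (𝓝 0)))
    (D : Submodule ℂ E)
    (hdense : ∀ v : E, enInter N₀ N₁ v ≠ ∞ → ∀ ε : ℝ≥0∞, 0 < ε →
          ∃ w ∈ D, enInter N₀ N₁ (v - w) < ε)
    (v : E) (hv : JN P₀ P₁ v ≠ ∞) (ε : ℝ≥0∞) (hε : 0 < ε) :
    ∃ d ∈ D, JN P₀ P₁ (v - d) < ε := by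
  have hε2 : 0 < ε / 2 := by simpa using hε.ne'
  obtain ⟨x, hx, hx0, hx1⟩ := JN_lt (lt_top_iff_ne_top.2 hv)
  have hb : ∀ {N : E → ℝ≥0∞} {a : ℝ} {P : (ℤ → E) → ℝ≥0∞}, WS N a P →
      (∀ n x, P (cesaro ℂ n x) ≤ P x) → ∀ n, P (cesaro ℂ n x - x) ≤ P x + P x := by
    intro N a P h hc n
    rw [sub_eq_add_neg]
    exact (h.add_le _ _).trans (add_le_add (hc n x) (h.neg x))
  have key : ∃ n : ℕ, ∃ m : ℤ,
      ENNReal.ofReal (Real.exp (θ * m)) * P₀ (cesaro ℂ n x - x) < ε / 2 ∧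
      ENNReal.ofReal (Real.exp (-(1 - θ) * m)) * P₁ (cesaro ℂ n x - x) < ε / 2 := by
    rcases hlim with hl | hl
    · obtain ⟨m, hm⟩ := small_exp (c := 1 - θ) (by linarith [hθ.2])
        (B := P₁ x + P₁ x) (by simp [hx1.ne]) hε2
      have h2 := ENNReal.Tendsto.const_mul (hl x hx0.ne)
        (a := ENNReal.ofReal (Real.exp (θ * (m : ℤ)))) (Or.inr (by simp))
      rw [mul_zero] at h2
      obtain ⟨n, hn⟩ := ((tendsto_order.1 h2).2 _ hε2).exists
      refine ⟨n, m, hn, lt_of_le_of_lt ?_ hm⟩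
      rw [Int.cast_natCast]
      gcongr
      exact hb h₁ hc₁ n
    · obtain ⟨m, hm⟩ := small_exp (c := θ) hθ.1
        (B := P₀ x + P₀ x) (by simp [hx0.ne]) hε2
      have h2 := ENNReal.Tendsto.const_mul (hl x hx1.ne)
        (a := ENNReal.ofReal (Real.exp (-(1 - θ) * ((-m : ℤ) : ℝ)))) (Or.inr (by simp))
      rw [mul_zero] at h2
      obtain ⟨n, hn⟩ := ((tendsto_order.1 h2).2 _ hε2).exists
      refine ⟨n, -m, lt_of_le_of_lt ?_ hm, hn⟩
      push_cast
      rw [mul_neg, ← neg_mul]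
      gcongr
      exact hb h₀ hc₀ n
  obtain ⟨n, m, hm0, hm1⟩ := key
  set y := cesaro ℂ n x with hy
  set s : Finset ℤ := Finset.Ioo (-(n + 1 : ℤ)) (n + 1)
  have hys : ∀ k ∉ s, y k = 0 := by
    intro k hk
    rw [hy, cesaro_eq_cw, cw_eq_zero, zero_smul]
    simp only [s, Finset.mem_Ioo, not_and_or, not_lt] at hk
    rcases hk with hk | hk
    · rw [abs_of_nonpos (by omega)]; omega
    · rw [abs_of_nonneg (by omega)]; omega
  have hysum : HasSum y (∑ k ∈ s, y k) := hasSum_sum_of_ne_finset_zero hys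
  set q := ∑ k ∈ s, y k
  have hfinq : enInter N₀ N₁ q ≠ ∞ := by
    simp only [enInter, ne_eq, max_eq_top, not_or]
    constructor
    · refine ne_top_of_le_ne_top ?_ (h₀.Nsum s y)
      rw [ne_eq, ENNReal.sum_eq_top]
      rintro ⟨k, _, hk⟩
      exact ne_top_of_le_ne_top (ENNReal.mul_ne_top (by simp) (ne_top_of_le_ne_top hx0.ne (hc₀ n x)))
        (h₀.coord y k) hk
    · refine ne_top_of_le_ne_top ?_ (h₁.Nsum s y)
      rw [ne_eq, ENNReal.sum_eq_top]
      rintro ⟨k, _, hk⟩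
      exact ne_top_of_le_ne_top (ENNReal.mul_ne_top (by simp) (ne_top_of_le_ne_top hx1.ne (hc₁ n x)))
        (h₁.coord y k) hk
  obtain ⟨d, hdD, hd⟩ := hdense q hfinq (ε / 2) hε2
  refine ⟨d, hdD, ?_⟩
  have e : v - d = -(q - v) + (q - d) := by abel
  rw [e, ← ENNReal.add_halves ε]
  refine (JN_add h₀ h₁ _ _).trans_lt (ENNReal.add_lt_add ?_ ?_)
  · refine (JN_neg h₀ h₁ _).trans_lt ((JN_shift h₀ h₁ _ _ (hysum.sub hx) m).trans_lt ?_)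
    exact max_lt hm0 hm1
  · exact (JN_single h₀ h₁ _).trans_lt hd

end

/-- The final constant. -/
noncomputable def Cfin (θ : ℝ) : ℝ≥0∞ := ENNReal.ofReal (Real.exp (1 - θ)) * (Kc θ + 1)

theorem stein_bound {E F : Type*} [NormedAddCommGroup E] [NormedSpace ℂ E] [CompleteSpace E]
    [NormedAddCommGroup F] [NormedSpace ℂ F] [CompleteSpace F] {θ : ℝ}
    (hθ : θ ∈ Set.Ioo (0 : ℝ) 1)
    {N₀ N₁ : E → ℝ≥0∞} {P₀ P₁ : (ℤ → E) → ℝ≥0∞} {M₀ M₁ : F → ℝ≥0∞} {Q₀ Q₁ : (ℤ → F) → ℝ≥0∞}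
    (h₀ : WS N₀ (Real.exp (-θ)) P₀) (h₁ : WS N₁ (Real.exp (1 - θ)) P₁)
    (g₀ : WS M₀ (Real.exp (-θ)) Q₀) (g₁ : WS M₁ (Real.exp (1 - θ)) Q₁)
    (hc₀ : ∀ n x, P₀ (cesaro ℂ n x) ≤ P₀ x) (hc₁ : ∀ n x, P₁ (cesaro ℂ n x) ≤ P₁ x)
    (D : Submodule ℂ E) (hD : ∀ w ∈ D, enInter N₀ N₁ w ≠ ∞)
    (hdense : ∀ v : E, enInter N₀ N₁ v ≠ ∞ → ∀ ε : ℝ≥0∞, 0 < ε →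
          ∃ w ∈ D, enInter N₀ N₁ (v - w) < ε)
    (A : E →ₗ[ℂ] F) (Mc₀ Mc₁ : ℝ≥0∞) (hm0 : 0 < Mc₀)
    (hm0' : Mc₀ ≠ ∞) (hm1 : 0 < Mc₁) (hm1' : Mc₁ ≠ ∞)
    (core : ∀ (x : ℤ → E) (s : Finset ℤ), (∀ k ∉ s, x k = 0) → (∀ k, x k ∈ D) →
      P₀ x ≠ ∞ → P₁ x ≠ ∞ → JN Q₀ Q₁ (A (∑ k ∈ s, x k)) ≤ max (Mc₀ * P₀ x) (Mc₁ * P₁ x))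
    (v : E) (hvD : v ∈ D) :
    JN Q₀ Q₁ (A v) ≤ Cfin θ * Mc₀ ^ (1 - θ) * Mc₁ ^ θ * JN P₀ P₁ v := by
  have hr0 : Mc₀ ^ (1 - θ) ≠ 0 := (ENNReal.rpow_pos hm0 hm0').ne'
  have hr1 : Mc₁ ^ θ ≠ 0 := (ENNReal.rpow_pos hm1 hm1').ne'
  have hr0' : Mc₀ ^ (1 - θ) ≠ ∞ := ENNReal.rpow_ne_top_of_nonneg (by linarith [hθ.2]) hm0'
  have hr1' : Mc₁ ^ θ ≠ ∞ := ENNReal.rpow_ne_top_of_nonneg hθ.1.le hm1'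
  have hK := Kc_ne_top hθ
  have hCf0 : Cfin θ ≠ 0 := mul_ne_zero (by simp [Real.exp_pos]) (by simp)
  have hCf : Cfin θ ≠ ∞ := ENNReal.mul_ne_top (by simp) (by simp [hK])
  have hG0 : Cfin θ * Mc₀ ^ (1 - θ) * Mc₁ ^ θ ≠ 0 := mul_ne_zero (mul_ne_zero hCf0 hr0) hr1
  have hGt : Cfin θ * Mc₀ ^ (1 - θ) * Mc₁ ^ θ ≠ ∞ :=
    ENNReal.mul_ne_top (ENNReal.mul_ne_top hCf hr0') hr1'
  have claim : ∀ x : ℤ → E, HasSum x v →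
      JN Q₀ Q₁ (A v) ≤ Cfin θ * Mc₀ ^ (1 - θ) * Mc₁ ^ θ * max (P₀ x) (P₁ x) := by
    intro x hx
    set B := max (P₀ x) (P₁ x) with hB
    by_cases hBt : B = ∞
    · rw [hBt, ENNReal.mul_top hG0]; exact le_top
    by_cases hB0 : B = 0
    · have h1 := JN_norm_le hθ h₀ h₁ v
      have h2 : JN P₀ P₁ v ≤ 0 := hB0 ▸ JN_le hx
      have h3 : v = 0 := by
        rw [nonpos_iff_eq_zero.1 h2] at h1
        simpa using h1
      rw [h3, map_zero, JN_zero g₀ g₁]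
      exact zero_le
    have hx0 : P₀ x ≠ ∞ := ne_top_of_le_ne_top hBt (le_max_left _ _)
    have hx1 : P₁ x ≠ ∞ := ne_top_of_le_ne_top hBt (le_max_right _ _)
    obtain ⟨d, s, hds, hdD, hsum, hd0, hd1⟩ := dense_rep hθ h₀ h₁ hc₀ hc₁ D hD hdense x v hvD hx
      hx0 hx1 B (pos_iff_ne_zero.2 hB0)
    have hd0' : P₀ d ≤ (Kc θ + 1) * B := by
      refine hd0.trans ?_
      rw [add_mul, one_mul]
      gcongr
      exact le_max_left _ _
    have hd1' : P₁ d ≤ (Kc θ + 1) * B := by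
      refine hd1.trans ?_
      rw [add_mul, one_mul]
      gcongr
      exact le_max_right _ _
    have hKB : (Kc θ + 1) * B ≠ ∞ := ENNReal.mul_ne_top (by simp [hK]) hBt
    obtain ⟨n, hn0, hn1⟩ := const_choice hθ Mc₀ Mc₁ hm0 hm0' hm1 hm1'
    set G := ENNReal.ofReal (Real.exp (1 - θ)) * Mc₀ ^ (1 - θ) * Mc₁ ^ θ with hG
    have s0 : P₀ (fun k => d (k + n)) ≤ ENNReal.ofReal (Real.exp (θ * n)) * ((Kc θ + 1) * B) := by
      refine (h₀.shift d n).trans ?_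
      rw [exp_zpow', show -θ * ((-n : ℤ) : ℝ) = θ * n by push_cast; ring]
      gcongr
    have s1 : P₁ (fun k => d (k + n)) ≤
        ENNReal.ofReal (Real.exp (-(1 - θ) * n)) * ((Kc θ + 1) * B) := by
      refine (h₁.shift d n).trans ?_
      rw [exp_zpow', show (1 - θ) * ((-n : ℤ) : ℝ) = -(1 - θ) * n by push_cast; ring]
      gcongr
    have hc := core (fun k => d (k + n)) (s.map (Equiv.subRight n).toEmbedding) (by
        intro k hk
        apply hds
        intro hk'
        apply hk
        rw [Finset.mem_map]
        exact ⟨k + n, hk', by simp⟩) (fun k => hdD _)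
      (ne_top_of_le_ne_top (ENNReal.mul_ne_top (by simp) hKB) s0)
      (ne_top_of_le_ne_top (ENNReal.mul_ne_top (by simp) hKB) s1)
    have hsum' : ∑ k ∈ s.map (Equiv.subRight n).toEmbedding, d (k + n) = v := by
      rw [Finset.sum_map, ← hsum]
      simp
    rw [hsum'] at hc
    have hfinal : G * ((Kc θ + 1) * B) = Cfin θ * Mc₀ ^ (1 - θ) * Mc₁ ^ θ * B := by
      rw [hG, Cfin]; ring
    rw [← hfinal]
    refine hc.trans (max_le ?_ ?_)
    · calc _ ≤ Mc₀ * (ENNReal.ofReal (Real.exp (θ * n)) * ((Kc θ + 1) * B)) := by gcongr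
        _ = (Mc₀ * ENNReal.ofReal (Real.exp (θ * n))) * ((Kc θ + 1) * B) := by ring
        _ ≤ _ := mul_le_mul_left hn0 _
    · calc _ ≤ Mc₁ * (ENNReal.ofReal (Real.exp (-(1 - θ) * n)) * ((Kc θ + 1) * B)) := by gcongr
        _ = (Mc₁ * ENNReal.ofReal (Real.exp (-(1 - θ) * n))) * ((Kc θ + 1) * B) := by ring
        _ ≤ _ := mul_le_mul_left hn1 _
  conv_rhs => unfold JN
  rw [ENNReal.mul_iInf_of_ne hG0 hGt]
  refine le_iInf fun x => ?_
  rw [ENNReal.mul_iInf_of_ne hG0 hGt]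
  exact le_iInf fun hx => claim x hx


/-- Stein interpolation. Let `{T(z)}_{z∈S̄}` be a family of linear
operators from a dense subspace `X̆ ⊆ X₀ ∩ X₁` into `Y₀+Y₁` such that `z ↦ T(z)x` belongs
to `ℋ_π(S̄;Y₀+Y₁)` for every `x ∈ X̆`, and such that for `j = 0,1` and every finitely
nonzero sequence `x⃗` with entries in `X̆`,
`‖ℱ(t ↦ ∑_k e^{ikt} T(j+it)x_k)‖_{𝔗_j} ≤ M_j ‖x⃗‖_{𝔖_j}`.  Then, with a constant
depending only on `θ`, `‖T(θ)x‖_{(𝒴₀,𝒴₁)_θ} ≲_θ M₀^{1-θ} M₁^{θ} ‖x‖_{(𝒳₀,𝒳₁)_θ}` for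
`x ∈ X̆`; in particular, if `𝔖₀` or `𝔖₁` is a `c₀`-sequence structure, `T(θ)` extends to a
bounded linear operator from `(𝒳₀,𝒳₁)_θ` to `(𝒴₀,𝒴₁)_θ`. -/
theorem statement17 (θ : ℝ) (hθ : θ ∈ Set.Ioo (0 : ℝ) 1) :
    ∃ C : ℝ≥0∞, C ≠ ∞ ∧
      ∀ (E : Type u) (F : Type v)
        [NormedAddCommGroup E] [NormedSpace ℂ E] [CompleteSpace E]
        [NormedAddCommGroup F] [NormedSpace ℂ F] [CompleteSpace F],
      ∀ N₀ N₁ : BanachENorm ℂ E,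
        (∀ v : E, enSum N₀.toFun N₁.toFun v = (‖v‖₊ : ℝ≥0∞)) →
      ∀ M₀ M₁ : BanachENorm ℂ F,
        (∀ w : F, enSum M₀.toFun M₁.toFun w = (‖w‖₊ : ℝ≥0∞)) →
      ∀ (S₀ : SeqStructure ℂ E N₀) (S₁ : SeqStructure ℂ E N₁),
        IsLinftySeqStructure S₀ → IsLinftySeqStructure S₁ →
      ∀ (T₀ : SeqStructure ℂ F M₀) (T₁ : SeqStructure ℂ F M₁),
      ∀ D : Submodule ℂ E,
        (∀ w ∈ D, enInter N₀.toFun N₁.toFun w ≠ ∞) →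
        (∀ v : E, enInter N₀.toFun N₁.toFun v ≠ ∞ → ∀ ε : ℝ≥0∞, 0 < ε →
          ∃ w ∈ D, enInter N₀.toFun N₁.toFun (v - w) < ε) →
      ∀ T : ℂ → E →ₗ[ℂ] F,
        (∀ x ∈ D, ContinuousOn (fun z => T z x) closedStrip) →
        (∀ x ∈ D, ∀ z ∈ openStrip, DifferentiableAt ℂ (fun z => T z x) z) →
        (∀ x ∈ D, ∀ z ∈ closedStrip, T (z + 2 * (Real.pi : ℂ) * Complex.I) x = T z x) →
      ∀ Mc₀ Mc₁ : ℝ≥0∞, 0 < Mc₀ → Mc₀ ≠ ∞ → 0 < Mc₁ → Mc₁ ≠ ∞ →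
        (∀ x : ℤ → E, (Function.support x).Finite → (∀ k, x k ∈ D) →
          T₀.toFun (fun k' : ℤ => (2 * (Real.pi : ℂ))⁻¹ •
              ∫ t in (-Real.pi)..Real.pi,
                Complex.exp (-(k' : ℂ) * Complex.I * (t : ℂ)) •
                  (∑ᶠ k : ℤ, Complex.exp ((k : ℂ) * Complex.I * (t : ℂ)) •
                    T ((0 : ℂ) + (t : ℂ) * Complex.I) (x k))) ≤
            Mc₀ * S₀.toFun x) →
        (∀ x : ℤ → E, (Function.support x).Finite → (∀ k, x k ∈ D) →
          T₁.toFun (fun k' : ℤ => (2 * (Real.pi : ℂ))⁻¹ •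
              ∫ t in (-Real.pi)..Real.pi,
                Complex.exp (-(k' : ℂ) * Complex.I * (t : ℂ)) •
                  (∑ᶠ k : ℤ, Complex.exp ((k : ℂ) * Complex.I * (t : ℂ)) •
                    T ((1 : ℂ) + (t : ℂ) * Complex.I) (x k))) ≤
            Mc₁ * S₁.toFun x) →
        (∀ x ∈ D,
          interpENorm T₀.toFun T₁.toFun θ (T (θ : ℂ) x) ≤
            C * Mc₀ ^ (1 - θ) * Mc₁ ^ θ * interpENorm S₀.toFun S₁.toFun θ x) ∧
        ((IsC0SeqStructure S₀ ∨ IsC0SeqStructure S₁) →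
          ∃ Tb : E → F,
            (∀ x ∈ D, Tb x = T (θ : ℂ) x) ∧
            (∀ v w : E, interpENorm S₀.toFun S₁.toFun θ v ≠ ∞ →
              interpENorm S₀.toFun S₁.toFun θ w ≠ ∞ → Tb (v + w) = Tb v + Tb w) ∧
            (∀ (c : ℂ) (v : E), interpENorm S₀.toFun S₁.toFun θ v ≠ ∞ →
              Tb (c • v) = c • Tb v) ∧
            (∀ v : E, interpENorm T₀.toFun T₁.toFun θ (Tb v) ≤
              C * Mc₀ ^ (1 - θ) * Mc₁ ^ θ * interpENorm S₀.toFun S₁.toFun θ v)) := by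
  have hr : Cfin θ ≠ ∞ := ENNReal.mul_ne_top (by simp) (by simp [Kc_ne_top hθ])
  have hr0 : Cfin θ ≠ 0 := mul_ne_zero (by simp [Real.exp_pos]) (by simp)
  refine ⟨Cfin θ, hr, ?_⟩
  intro E F _ _ _ _ _ _ N₀ N₁ hN M₀ M₁ hM S₀ S₁ hS₀ hS₁ T₀ T₁ D hD hdense T hTc hTd hTp
    Mc₀ Mc₁ hm0 hm0' hm1 hm1' hb₀ hb₁
  have h₀ := WS.of N₀ (fun v => (enSum_norm_le N₀ N₁ hN v).1) S₀ (Real.exp (-θ)) (Real.exp_pos _)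
  have h₁ := WS.of N₁ (fun v => (enSum_norm_le N₀ N₁ hN v).2) S₁ (Real.exp (1 - θ)) (Real.exp_pos _)
  have g₀ := WS.of M₀ (fun v => (enSum_norm_le M₀ M₁ hM v).1) T₀ (Real.exp (-θ)) (Real.exp_pos _)
  have g₁ := WS.of M₁ (fun v => (enSum_norm_le M₀ M₁ hM v).2) T₁ (Real.exp (1 - θ)) (Real.exp_pos _)
  have hc₀ : ∀ n x, wtSeq (Real.exp (-θ)) S₀.toFun (cesaro ℂ n x) ≤
      wtSeq (Real.exp (-θ)) S₀.toFun x := fun n x => by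
    rw [wtSeq_cesaro]; exact hS₀ n _
  have hc₁ : ∀ n x, wtSeq (Real.exp (1 - θ)) S₁.toFun (cesaro ℂ n x) ≤
      wtSeq (Real.exp (1 - θ)) S₁.toFun x := fun n x => by
    rw [wtSeq_cesaro]; exact hS₁ n _
  have bound : ∀ x ∈ D,
      JN (wtSeq (Real.exp (-θ)) T₀.toFun) (wtSeq (Real.exp (1 - θ)) T₁.toFun) (T (θ : ℂ) x) ≤
        Cfin θ * Mc₀ ^ (1 - θ) * Mc₁ ^ θ *
        JN (wtSeq (Real.exp (-θ)) S₀.toFun) (wtSeq (Real.exp (1 - θ)) S₁.toFun) x :=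
    stein_bound hθ h₀ h₁ g₀ g₁ hc₀ hc₁ D hD hdense (T (θ : ℂ)) Mc₀ Mc₁ hm0 hm0' hm1 hm1'
      (fun x s hxs hxD hx0 hx1 => stein_core hθ g₀ g₁ D T hTc hTd hTp Mc₀ Mc₁ hm0' hm1' hb₀ hb₁
        x s hxs hxD hx0 hx1)
  refine ⟨bound, fun hc => ?_⟩
  have hwt : ∀ (a : ℝ) (X : BanachENorm ℂ E) (S : SeqStructure ℂ E X), IsC0SeqStructure S →
      ∀ x, wtSeq a S.toFun x ≠ ∞ →
        Tendsto (fun n => wtSeq a S.toFun (cesaro ℂ n x - x)) atTop (𝓝 0) := by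
    intro a X S hS x hx
    refine (hS.2 _ hx).congr fun n => ?_
    unfold wtSeq
    congr 1; ext k
    simp only [Pi.sub_apply, cesaro_eq_cw, smul_sub]
    rw [smul_comm]
  have hlim := hc.imp (hwt (Real.exp (-θ)) N₀ S₀) (hwt (Real.exp (1 - θ)) N₁ S₁)
  have hq0 : Mc₀ ^ (1 - θ) ≠ 0 := (ENNReal.rpow_pos hm0 hm0').ne'
  have hq1 : Mc₁ ^ θ ≠ 0 := (ENNReal.rpow_pos hm1 hm1').ne'
  have hq0' : Mc₀ ^ (1 - θ) ≠ ∞ := ENNReal.rpow_ne_top_of_nonneg (by linarith [hθ.2]) hm0'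
  have hq1' : Mc₁ ^ θ ≠ ∞ := ENNReal.rpow_ne_top_of_nonneg hθ.1.le hm1'
  exact extend_lemma D (T (θ : ℂ))
    (JN (wtSeq (Real.exp (-θ)) S₀.toFun) (wtSeq (Real.exp (1 - θ)) S₁.toFun))
    (JN (wtSeq (Real.exp (-θ)) T₀.toFun) (wtSeq (Real.exp (1 - θ)) T₁.toFun))
    (Lc θ) (Cfin θ * Mc₀ ^ (1 - θ) * Mc₁ ^ θ) (Lc_ne_top hθ)
    (ENNReal.mul_ne_top (ENNReal.mul_ne_top hr hq0') hq1')
    (mul_ne_zero (mul_ne_zero hr0 hq0) hq1)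
    (JN_zero h₀ h₁) (JN_add h₀ h₁) (JN_smul h₀ h₁)
    (fun v hv => ne_top_of_le_ne_top (hD v hv) (JN_single h₀ h₁ v))
    (JN_norm_le hθ g₀ g₁) (JN_tsum hθ g₀ g₁) bound
    (dense_JN hθ h₀ h₁ hc₀ hc₁ hlim D hdense)
end

section
/- Let (𝒳₀,𝒳₁) and (𝒴₀,𝒴₁) be compatible couples of sequentially structured Banach spaces. Let 0 ≤ θ₀ < θ₁ ≤ 1 and θ ∈ (0,1), set ω = (1−θ)θ₀ + θθ₁, and take a, b ∈ (1,∞) with b = a^{θ₁−θ₀}. Suppose that for j = 0,1 there are continuous embeddings 𝔖₀(a^{−θ_j}) ∩ 𝔖₁(a^{1−θ_j}) ↪ 𝔗_j ↪ 𝔖₀(a^{−θ_j}) + 𝔖₁(a^{1−θ_j}). Then (𝒳₀,𝒳₁)_{ω;a} = (𝒴₀,𝒴₁)_{θ;b} with equivalent norms. -/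
open scoped ENNReal NNReal
open Filter Topology

universe u v

namespace Reit

theorem en_zero {E : Type*} [AddCommGroup E] [Module ℝ E] {N : E → ℝ≥0∞}
    (hN : IsBanachENorm ℝ N) : N 0 = 0 := by
  have h := hN.2.2.1 0 0
  simpa using h

theorem en_neg {E : Type*} [AddCommGroup E] [Module ℝ E] {N : E → ℝ≥0∞}
    (hN : IsBanachENorm ℝ N) (x : E) : N (-x) ≤ N x := by
  have h := hN.2.2.1 (-1) x
  simpa using h

theorem en_sub {E : Type*} [AddCommGroup E] [Module ℝ E] {N : E → ℝ≥0∞}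
    (hN : IsBanachENorm ℝ N) (x y : E) : N (x - y) ≤ N x + N y := by
  rw [sub_eq_add_neg]
  exact (hN.2.1 _ _).trans (add_le_add le_rfl (en_neg hN y))

theorem en_sum {E ι : Type*} [AddCommGroup E] [Module ℝ E] {N : E → ℝ≥0∞}
    (hN : IsBanachENorm ℝ N) (s : Finset ι) (f : ι → E) :
    N (∑ i ∈ s, f i) ≤ ∑ i ∈ s, N (f i) := by
  classical
  induction s using Finset.induction_on with
  | empty => simp [en_zero hN]
  | insert i s hi ih =>
    rw [Finset.sum_insert hi, Finset.sum_insert hi]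
    exact (hN.2.1 _ _).trans (add_le_add le_rfl ih)

/-- Absolutely convergent series converge. -/
theorem en_series {E : Type*} [AddCommGroup E] [Module ℝ E] {N : E → ℝ≥0∞}
    (hN : IsBanachENorm ℝ N) (f : ℕ → E) (hf : ∑' n, N (f n) ≠ ∞) :
    ∃ x : E, N x ≤ ∑' n, N (f n) ∧
      Tendsto (fun n => N (∑ i ∈ Finset.range n, f i - x)) atTop (𝓝 0) := by
  have hfin : ∀ n, N (∑ i ∈ Finset.range n, f i) ≤ ∑' n, N (f n) := fun n =>
    (en_sum hN _ _).trans (ENNReal.sum_le_tsum _)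
  have htail := ENNReal.tendsto_sum_nat_add (fun n => N (f n)) hf
  have key : ∀ n₀ m, n₀ ≤ m → N (∑ i ∈ Finset.range m, f i - ∑ i ∈ Finset.range n₀, f i)
      ≤ ∑' k, N (f (k + n₀)) := by
    intro n₀ m h
    obtain ⟨d, rfl⟩ := Nat.exists_eq_add_of_le h
    rw [Finset.sum_range_add, add_sub_cancel_left]
    refine (en_sum hN _ _).trans ?_
    simp_rw [add_comm n₀]
    exact ENNReal.sum_le_tsum (f := fun k => N (f (k + n₀))) _
  obtain ⟨x, hx, hlim⟩ := hN.2.2.2 (fun n => ∑ i ∈ Finset.range n, f i)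
    (fun n => ne_top_of_le_ne_top hf (hfin n)) (by
      intro ε hε
      have h2 : (0 : ℝ≥0∞) < ε / 2 := ENNReal.half_pos hε.ne'
      obtain ⟨n₀, hn₀⟩ := ((tendsto_order.1 htail).2 _ h2).exists
      refine ⟨n₀, fun m hm n hn => ?_⟩
      have : (∑ i ∈ Finset.range m, f i - ∑ i ∈ Finset.range n, f i)
        = (∑ i ∈ Finset.range m, f i - ∑ i ∈ Finset.range n₀, f i)
          - (∑ i ∈ Finset.range n, f i - ∑ i ∈ Finset.range n₀, f i) := by abel
      rw [this]
      calc _ ≤ _ := en_sub hN _ _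
        _ ≤ _ := add_le_add (key n₀ m hm) (key n₀ n hn)
        _ < ε / 2 + ε / 2 := ENNReal.add_lt_add hn₀ hn₀
        _ = ε := ENNReal.add_halves ε)
  refine ⟨x, ?_, hlim⟩
  have h1 : ∀ n, N x ≤ ∑' n, N (f n) + N (∑ i ∈ Finset.range n, f i - x) := by
    intro n
    have : x = (∑ i ∈ Finset.range n, f i) - (∑ i ∈ Finset.range n, f i - x) := by abel
    calc N x = N ((∑ i ∈ Finset.range n, f i) - (∑ i ∈ Finset.range n, f i - x)) := by rw [← this]
      _ ≤ _ := en_sub hN _ _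
      _ ≤ _ := add_le_add (hfin n) le_rfl
  have h2 := (tendsto_const_nhds (x := ∑' n, N (f n))).add hlim
  rw [add_zero] at h2
  exact ge_of_tendsto' h2 h1

theorem en_sum_le₀ {E : Type*} [NormedAddCommGroup E] [NormedSpace ℝ E]
    (N₀ N₁ : BanachENorm ℝ E)
    (hcompE : ∀ v : E, enSum N₀.toFun N₁.toFun v = (‖v‖₊ : ℝ≥0∞)) (v : E) :
    ‖v‖ₑ ≤ N₀.toFun v := by
  have : ‖v‖ₑ = enSum N₀.toFun N₁.toFun v := by rw [hcompE]; rfl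
  rw [this]
  refine (iInf_le _ v).trans ?_
  simp [en_zero N₁.isBanachENorm]

theorem en_sum_le₁ {E : Type*} [NormedAddCommGroup E] [NormedSpace ℝ E]
    (N₀ N₁ : BanachENorm ℝ E)
    (hcompE : ∀ v : E, enSum N₀.toFun N₁.toFun v = (‖v‖₊ : ℝ≥0∞)) (v : E) :
    ‖v‖ₑ ≤ N₁.toFun v := by
  have : ‖v‖ₑ = enSum N₀.toFun N₁.toFun v := by rw [hcompE]; rfl
  rw [this]
  refine (iInf_le _ 0).trans ?_
  simp [en_zero N₀.isBanachENorm]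

theorem tendsto_of_en {E ι : Type*} [NormedAddCommGroup E] {N : E → ℝ≥0∞}
    (hle : ∀ v, ‖v‖ₑ ≤ N v) {l : Filter ι} {f : ι → E} {x : E}
    (h : Tendsto (fun n => N (f n - x)) l (𝓝 0)) : Tendsto f l (𝓝 x) := by
  rw [tendsto_iff_edist_tendsto_0]
  refine tendsto_of_tendsto_of_tendsto_of_le_of_le tendsto_const_nhds h (fun _ => zero_le) ?_
  intro n
  simp only [edist_eq_enorm_sub]
  exact hle _

theorem complete_of_comp {E : Type*} [NormedAddCommGroup E] [NormedSpace ℝ E]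
    (N₀ N₁ : BanachENorm ℝ E)
    (hcompE : ∀ v : E, enSum N₀.toFun N₁.toFun v = (‖v‖₊ : ℝ≥0∞)) : CompleteSpace E := by
  refine NormedAddCommGroup.completeSpace_of_summable_imp_tendsto fun u hu => ?_
  obtain ⟨ε, hε, hεs⟩ := ENNReal.exists_pos_sum_of_countable (ε := 1) one_ne_zero ℕ
  have hex : ∀ n, ∃ w, N₀.toFun w + N₁.toFun (u n - w) < ‖u n‖ₑ + ε n := by
    intro n
    have h : enSum N₀.toFun N₁.toFun (u n) < ‖u n‖ₑ + ε n := by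
      rw [hcompE]
      exact ENNReal.lt_add_right enorm_ne_top (by exact_mod_cast (hε n).ne')
    exact iInf_lt_iff.1 h
  choose w hw using hex
  have hfin : ∑' n, (‖u n‖ₑ + ε n) ≠ ∞ := by
    rw [ENNReal.tsum_add]
    refine ENNReal.add_ne_top.2 ⟨?_, hεs.ne_top⟩
    have : Summable fun n => ‖u n‖₊ := by
      rw [← NNReal.summable_coe]; exact hu
    exact ENNReal.tsum_coe_ne_top_iff_summable.2 this
  obtain ⟨x, -, hx⟩ := en_series N₀.isBanachENorm w
    (ne_top_of_le_ne_top hfin (ENNReal.tsum_le_tsum fun n => le_self_add.trans (hw n).le))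
  obtain ⟨y, -, hy⟩ := en_series N₁.isBanachENorm (fun n => u n - w n)
    (ne_top_of_le_ne_top hfin (ENNReal.tsum_le_tsum fun n => le_add_self.trans (hw n).le))
  refine ⟨x + y, ?_⟩
  have := (tendsto_of_en (en_sum_le₀ N₀ N₁ hcompE) hx).add
    (tendsto_of_en (en_sum_le₁ N₀ N₁ hcompE) hy)
  refine this.congr fun n => ?_
  rw [← Finset.sum_add_distrib]
  simp

theorem wt_banach {E : Type*} [AddCommGroup E] [Module ℝ E] {S : (ℤ → E) → ℝ≥0∞}
    (hS : IsBanachENorm ℝ S) {α : ℝ} (hα : 0 < α) : IsBanachENorm ℝ (wtSeq α S) := by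
  have hk : ∀ k : ℤ, α ^ k ≠ 0 := fun k => (zpow_pos hα k).ne'
  refine ⟨?_, ?_, ?_, ?_⟩
  · intro x hx
    have := hS.1 _ hx
    funext k
    have h2 := congrFun this k
    simpa [hk k] using h2
  · intro x y
    have := hS.2.1 (fun k => α ^ k • x k) (fun k => α ^ k • y k)
    refine le_trans (le_of_eq ?_) this
    unfold wtSeq; congr 1; funext k; simp
  · intro c x
    have := hS.2.2.1 c (fun k => α ^ k • x k)
    refine le_trans (le_of_eq ?_) this
    unfold wtSeq; congr 1; funext k
    simp only [Pi.smul_apply]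
    rw [smul_comm]
  · intro f hf hc
    obtain ⟨g, hg, hlim⟩ := hS.2.2.2 (fun n k => α ^ k • f n k) hf (by
      intro ε hε
      obtain ⟨n₀, h⟩ := hc ε hε
      refine ⟨n₀, fun m hm n hn => lt_of_eq_of_lt ?_ (h m hm n hn)⟩
      unfold wtSeq; congr 1; funext k; simp [smul_sub])
    refine ⟨fun k => (α ^ k)⁻¹ • g k, ?_, ?_⟩
    · unfold wtSeq
      simpa [smul_smul, hk] using hg
    · refine hlim.congr fun n => ?_
      unfold wtSeq; congr 1; funext k; simp [smul_sub, smul_smul, hk]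

theorem wt_coord {E : Type*} [NormedAddCommGroup E] [NormedSpace ℝ E] {N : BanachENorm ℝ E}
    (hN : ∀ v, ‖v‖ₑ ≤ N.toFun v) (S : SeqStructure ℝ E N) {α : ℝ} (hα : 0 < α)
    (x : ℤ → E) (k : ℤ) : ‖x k‖ₑ ≤ ENNReal.ofReal (α ^ (-k)) * wtSeq α S.toFun x := by
  have h1 : ‖α ^ k • x k‖ₑ ≤ wtSeq α S.toFun x := (hN _).trans (S.coord (fun k => α ^ k • x k) k)
  have h2 : x k = α ^ (-k) • (α ^ k • x k) := by
    rw [smul_smul, ← zpow_add₀ hα.ne']; simp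
  calc ‖x k‖ₑ = ‖α ^ (-k)‖ₑ * ‖α ^ k • x k‖ₑ := by rw [← enorm_smul, ← h2]
    _ = ENNReal.ofReal (α ^ (-k)) * ‖α ^ k • x k‖ₑ := by
        rw [Real.enorm_of_nonneg (zpow_pos hα _).le]
    _ ≤ _ := by gcongr

theorem wt_shift {E : Type*} [AddCommGroup E] [Module ℝ E] {N : BanachENorm ℝ E}
    (S : SeqStructure ℝ E N) {α : ℝ} (hα : 0 < α) (x : ℤ → E) (n : ℤ) :
    wtSeq α S.toFun (fun k => x (k + n)) ≤ ENNReal.ofReal (α ^ (-n)) * wtSeq α S.toFun x := by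
  have h1 := S.shift (fun k => α ^ k • x k) n
  have h2 := S.isBanachENorm.2.2.1 (α ^ (-n)) (fun k => α ^ (k + n) • x (k + n))
  rw [h1] at h2
  have h3 : ((‖α ^ (-n)‖₊ : ℝ≥0) : ℝ≥0∞) = ENNReal.ofReal (α ^ (-n)) :=
    Real.enorm_of_nonneg (zpow_pos hα _).le
  rw [h3] at h2
  refine le_trans (le_of_eq ?_) h2
  unfold wtSeq; congr 1; funext k
  simp only [Pi.smul_apply]
  rw [smul_smul, ← zpow_add₀ hα.ne']
  congr 2; ring

theorem wt_wt {E : Type*} [AddCommGroup E] [Module ℝ E] (S : (ℤ → E) → ℝ≥0∞)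
    (α γ : ℝ) (x : ℤ → E) : wtSeq α S (fun k => γ ^ k • x k) = wtSeq (α * γ) S x := by
  unfold wtSeq; congr 1; funext k
  rw [smul_smul, mul_zpow]

theorem summable_min {α β : ℝ} (hα0 : 0 < α) (hα : α < 1) (hβ : 1 < β) :
    Summable fun j : ℤ => min (α ^ (-j)) (β ^ (-j)) := by
  have hβ0 : 0 < β := one_pos.trans hβ
  have hnn : ∀ j : ℤ, 0 ≤ min (α ^ (-j)) (β ^ (-j)) := fun j =>
    le_min (zpow_pos hα0 _).le (zpow_pos hβ0 _).le
  refine Summable.of_nat_of_neg ?_ ?_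
  · refine Summable.of_nonneg_of_le (fun n => hnn _) (fun n => min_le_right _ _) ?_
    refine (summable_geometric_of_lt_one (inv_nonneg.2 hβ0.le) (inv_lt_one_of_one_lt₀ hβ)).congr ?_
    intro n; simp
  · refine Summable.of_nonneg_of_le (fun n => hnn _) (fun n => min_le_left _ _) ?_
    refine (summable_geometric_of_lt_one hα0.le hα).congr ?_
    intro n; simp

theorem hasSum_telescope {E : Type*} [NormedAddCommGroup E] (P : ℤ → E) (y : E)
    (hs : Summable fun n => P n - P (n + 1))
    (h1 : Tendsto (fun n : ℕ => P n) atTop (𝓝 0))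
    (h2 : Tendsto (fun n : ℕ => P (-n)) atTop (𝓝 y)) [CompleteSpace E] :
    HasSum (fun n => P n - P (n + 1)) y := by
  have e : y = (P 0 - 0) + (y - P 0) := by abel
  rw [e]
  refine HasSum.of_nat_of_neg_add_one (f := fun n => P n - P (n + 1)) ?_ ?_
  · have hs' : Summable fun n : ℕ => P n - P (n + 1) :=
      hs.comp_injective (i := fun n : ℕ => (n : ℤ)) Nat.cast_injective
    rw [hs'.hasSum_iff_tendsto_nat]
    refine (h1.const_sub (P 0)).congr fun n => ?_
    have := Finset.sum_range_sub' (fun i : ℕ => P i) n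
    simpa using this.symm
  · have hs' : Summable fun n : ℕ => P (-(n + 1)) - P (-(n + 1) + 1) :=
      hs.comp_injective (i := fun n : ℕ => (-(n + 1) : ℤ)) (fun a b h => by simpa using h)
    rw [hs'.hasSum_iff_tendsto_nat]
    refine (h2.sub_const (P 0)).congr fun n => ?_
    have := Finset.sum_range_sub (fun i : ℕ => P (-i)) n
    simpa using this.symm

theorem kstep {E F : Type*} [NormedAddCommGroup E] [NormedSpace ℝ E]
    [NormedAddCommGroup F] [NormedSpace ℝ F]
    {N₀ N₁ : BanachENorm ℝ E} {M : BanachENorm ℝ F}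
    (S₀ : SeqStructure ℝ E N₀) (S₁ : SeqStructure ℝ E N₁) (T : SeqStructure ℝ F M)
    (ι : F →L[ℝ] E) {σ τ γ : ℝ} (hσ : 0 < σ) (hτ : 0 < τ) (hγ : 0 < γ) (C : ℝ≥0∞)
    (hC : ∀ y : ℤ → F, enSum (wtSeq σ S₀.toFun) (wtSeq τ S₁.toFun)
      (fun k => ι (y k)) ≤ C * T.toFun y) (y : ℤ → F) (D : ℝ≥0∞)
    (hD : C * wtSeq γ T.toFun y < D) (m : ℤ) :
    ∃ p : ℤ → E, wtSeq (σ * γ) S₀.toFun p ≤ ENNReal.ofReal (σ ^ m) * D ∧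
      wtSeq (τ * γ) S₁.toFun ((fun k => ι (y k)) - p) ≤ ENNReal.ofReal (τ ^ m) * D := by
  have h1 := hC (fun k => γ ^ (k + m) • y (k + m))
  rw [T.shift (fun k => γ ^ k • y k) m] at h1
  obtain ⟨w, hw⟩ := iInf_lt_iff.1 (lt_of_le_of_lt h1 hD)
  have hk : ∀ k : ℤ, γ ^ k ≠ 0 := fun k => (zpow_pos hγ k).ne'
  refine ⟨fun k => (γ ^ k)⁻¹ • w (k + -m), ?_, ?_⟩
  · rw [← wt_wt]
    simp only [smul_smul, mul_inv_cancel₀ (hk _), one_smul]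
    refine (wt_shift S₀ hσ w (-m)).trans ?_
    rw [neg_neg]
    gcongr
    exact le_self_add.trans hw.le
  · rw [← wt_wt]
    have := (wt_shift S₁ hτ ((fun k => ι (γ ^ (k + m) • y (k + m))) - w) (-m))
    rw [neg_neg] at this
    refine le_trans (le_of_eq ?_) (this.trans ?_)
    · congr 1; funext k
      simp [smul_sub, smul_smul, hk]
    · gcongr
      exact le_add_self.trans hw.le

set_option maxHeartbeats 1000000 in
theorem mainstep {E : Type*} [NormedAddCommGroup E] [NormedSpace ℝ E]
    (N₀ N₁ : BanachENorm ℝ E)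
    (hcompE : ∀ v : E, enSum N₀.toFun N₁.toFun v = (‖v‖₊ : ℝ≥0∞))
    (S₀ : SeqStructure ℝ E N₀) (S₁ : SeqStructure ℝ E N₁)
    {α β : ℝ} (hα0 : 0 < α) (hα : α < 1) (hβ : 1 < β)
    (r : ℤ → ℝ) (hr0 : ∀ n, 0 ≤ r n) (hr : Summable r)
    (D : ℝ≥0∞) (hD : D ≠ ∞) (y : ℤ → E) (u : E) (hy : HasSum y u)
    (p : ℤ → ℤ → E)
    (hp0 : ∀ n, wtSeq α S₀.toFun (p n) ≤ ENNReal.ofReal (α ^ n * r n) * D)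
    (hp1 : ∀ n, wtSeq β S₁.toFun (y - p n) ≤ ENNReal.ofReal (β ^ n * r n) * D) :
    ∃ x : ℤ → E, HasSum x u ∧
      wtSeq α S₀.toFun x ≤ (∑' n, ENNReal.ofReal (r n + β * r (n + 1))) * D ∧
      wtSeq β S₁.toFun x ≤ (∑' n, ENNReal.ofReal (r n + β * r (n + 1))) * D := by
  have hβ0 : 0 < β := one_pos.trans hβ
  have := complete_of_comp N₀ N₁ hcompE
  have hN0 := en_sum_le₀ N₀ N₁ hcompE
  have hN1 := en_sum_le₁ N₀ N₁ hcompE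
  have hB0 := wt_banach S₀.isBanachENorm hα0
  have hB1 := wt_banach S₁.isBanachENorm hβ0
  set g : ℤ → ℝ := fun n => r n + β * r (n + 1) with hg
  have hg0 : ∀ n, 0 ≤ g n := fun n => add_nonneg (hr0 _) (mul_nonneg hβ0.le (hr0 _))
  have hgs : Summable g := by
    refine hr.add (Summable.mul_left _ ?_)
    exact hr.comp_injective (i := fun n : ℤ => n + 1) (add_left_injective 1)
  have hgt : ∑' n, ENNReal.ofReal (g n) ≠ ∞ := hgs.tsum_ofReal_ne_top
  -- the differences and their shifts
  set d : ℤ → ℤ → E := fun n => p n - p (n + 1) with hd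
  set X : ℤ → ℤ → E := fun n k => d n (k + n) with hX
  have aux : ∀ c : ℝ, 0 < c → c ≤ β → ∀ n : ℤ, ENNReal.ofReal (c ^ (-n)) *
      (ENNReal.ofReal (c ^ n * r n) * D + ENNReal.ofReal (c ^ (n + 1) * r (n + 1)) * D)
      ≤ ENNReal.ofReal (g n) * D := by
    intro c hc hcβ n
    rw [← add_mul, ← mul_assoc, ← ENNReal.ofReal_add
      (mul_nonneg (zpow_pos hc _).le (hr0 _)) (mul_nonneg (zpow_pos hc _).le (hr0 _)),
      ← ENNReal.ofReal_mul (zpow_pos hc _).le]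
    gcongr
    have : c ^ (-n) * (c ^ n * r n + c ^ (n + 1) * r (n + 1)) = r n + c * r (n + 1) := by
      rw [zpow_add₀ hc.ne', zpow_neg]
      have := (zpow_pos hc n).ne'
      field_simp
    rw [this]
    have := mul_le_mul_of_nonneg_right hcβ (hr0 (n + 1))
    simp only [hg]; linarith
  have hX0 : ∀ n, wtSeq α S₀.toFun (X n) ≤ ENNReal.ofReal (g n) * D := by
    intro n
    refine (wt_shift S₀ hα0 (d n) n).trans (le_trans ?_ (aux α hα0 (hα.trans hβ).le n))
    gcongr
    exact (en_sub hB0 _ _).trans (add_le_add (hp0 _) (hp0 _))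
  have hX1 : ∀ n, wtSeq β S₁.toFun (X n) ≤ ENNReal.ofReal (g n) * D := by
    intro n
    refine (wt_shift S₁ hβ0 (d n) n).trans (le_trans ?_ (aux β hβ0 le_rfl n))
    gcongr
    have e : d n = (y - p (n + 1)) - (y - p n) := by simp only [hd]; abel
    rw [e, add_comm (ENNReal.ofReal _ * D)]
    exact (en_sub hB1 _ _).trans (add_le_add (hp1 _) (hp1 _))
  -- summability of the double series
  have hXE : ∀ n j, ‖X n j‖ ≤ D.toReal * (g n * min (α ^ (-j)) (β ^ (-j))) := by
    intro n j
    have b0 := (wt_coord hN0 S₀ hα0 (X n) j).trans (mul_le_mul_right (hX0 n) _)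
    have b1 := (wt_coord hN1 S₁ hβ0 (X n) j).trans (mul_le_mul_right (hX1 n) _)
    have cv : ∀ t : ℝ, 0 < t → ‖X n j‖ₑ ≤ ENNReal.ofReal t * (ENNReal.ofReal (g n) * D) →
        ‖X n j‖ ≤ D.toReal * (g n * t) := by
      intro t ht h
      have := ENNReal.toReal_mono (by finiteness) h
      rw [toReal_enorm, ENNReal.toReal_mul, ENNReal.toReal_mul, ENNReal.toReal_ofReal ht.le,
        ENNReal.toReal_ofReal (hg0 n)] at this
      linarith
    rcases min_choice (α ^ (-j)) (β ^ (-j)) with h | h <;> rw [h]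
    · exact cv _ (zpow_pos hα0 _) b0
    · exact cv _ (zpow_pos hβ0 _) b1
  have hdouble : Summable fun q : ℤ × ℤ => X q.1 q.2 := by
    refine Summable.of_norm_bounded (g := fun q : ℤ × ℤ =>
      D.toReal * (g q.1 * min (α ^ (-q.2)) (β ^ (-q.2)))) ?_ (fun q => hXE q.1 q.2)
    refine Summable.mul_left _ ?_
    exact Summable.mul_of_nonneg hgs (summable_min hα0 hα hβ) hg0
      (fun j => le_min (zpow_pos hα0 _).le (zpow_pos hβ0 _).le)
  obtain ⟨t, ht⟩ := hdouble
  -- the limit sequence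
  let e := Equiv.intEquivNat.symm
  have htop : ∀ (f : ℤ → ℝ≥0∞), (∀ n, f n ≤ ENNReal.ofReal (g n) * D) →
      ∑' n : ℕ, f (e n) ≤ (∑' n, ENNReal.ofReal (g n)) * D := by
    intro f hf
    rw [e.tsum_eq, ← ENNReal.tsum_mul_right]
    exact ENNReal.tsum_le_tsum hf
  have hfinal : (∑' n, ENNReal.ofReal (g n)) * D ≠ ∞ := ENNReal.mul_ne_top hgt hD
  obtain ⟨x, hx, hxl⟩ := en_series hB0 (fun n => X (e n))
    (ne_top_of_le_ne_top hfinal (htop (fun n => wtSeq α S₀.toFun (X n)) hX0))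
  obtain ⟨x', hx', hxl'⟩ := en_series hB1 (fun n => X (e n))
    (ne_top_of_le_ne_top hfinal (htop (fun n => wtSeq β S₁.toFun (X n)) hX1))
  have lim : ∀ {N : BanachENorm ℝ E} (hN : ∀ v, ‖v‖ₑ ≤ N.toFun v) (S : SeqStructure ℝ E N)
      {c : ℝ} (hc : 0 < c) (x : ℤ → E)
      (h : Tendsto (fun n => wtSeq c S.toFun (∑ i ∈ Finset.range n, X (e i) - x)) atTop (𝓝 0))
      (j : ℤ), HasSum (fun n => X n j) (x j) := by
    intro N hN S c hc x h j
    have hs : Summable fun n => X n j :=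
      ht.summable.comp_injective (i := fun n : ℤ => (n, j)) (fun a b h => by simpa using h)
    rw [← e.hasSum_iff]
    have hs' : Summable ((fun n => X n j) ∘ e) := e.summable_iff.2 hs
    rw [hs'.hasSum_iff_tendsto_nat]
    rw [tendsto_iff_edist_tendsto_0]
    have h0 := ENNReal.Tendsto.const_mul (a := ENNReal.ofReal (c ^ (-j))) h
      (Or.inr ENNReal.ofReal_ne_top)
    rw [mul_zero] at h0
    refine tendsto_of_tendsto_of_tendsto_of_le_of_le tendsto_const_nhds h0 (fun _ => zero_le) ?_
    intro n
    have := wt_coord hN S hc (∑ i ∈ Finset.range n, X (e i) - x) j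
    simp only [edist_eq_enorm_sub]
    simpa [Finset.sum_apply] using this
  have l0 := lim hN0 S₀ hα0 x hxl
  have l1 := lim hN1 S₁ hβ0 x' hxl'
  have hxx : x' = x := funext fun j => (l1 j).unique (l0 j)
  rw [hxx] at hx'
  refine ⟨x, ?_, hx.trans (htop (fun n => wtSeq α S₀.toFun (X n)) hX0),
    hx'.trans (htop (fun n => wtSeq β S₁.toFun (X n)) hX1)⟩
  -- sums agree
  have hxt : HasSum x t := by
    have ht' : HasSum (fun q : ℤ × ℤ => X q.2 q.1) t :=
      (Equiv.prodComm ℤ ℤ).hasSum_iff.2 ht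
    exact ht'.prod_fiberwise l0
  have hrb : Tendsto r cofinite (𝓝 0) := hr.tendsto_cofinite_zero
  have ofR : ∀ {f : ℕ → ℝ} (c : ℝ), Tendsto f atTop (𝓝 0) → Tendsto (fun n =>
      ENNReal.ofReal c * (ENNReal.ofReal (f n) * D)) atTop (𝓝 0) := by
    intro f c hf
    have h1 := ENNReal.tendsto_ofReal hf
    rw [ENNReal.ofReal_zero] at h1
    have h2 := ENNReal.Tendsto.mul_const (b := D) h1 (Or.inr hD)
    rw [zero_mul] at h2
    have h3 := ENNReal.Tendsto.const_mul (a := ENNReal.ofReal c) h2 (Or.inr ENNReal.ofReal_ne_top)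
    rwa [mul_zero] at h3
  have hyk : ∀ k, HasSum (fun n => d n k) (y k) := by
    intro k
    have hs : Summable fun n => d n k := by
      have := ht.summable.comp_injective (i := fun n : ℤ => (n, k - n)) (fun a b h => by
        simpa using congrArg Prod.fst h)
      refine this.congr fun n => ?_
      simp [hX]
    refine hasSum_telescope (fun n => p n k) (y k) hs ?_ ?_
    · rw [tendsto_iff_edist_tendsto_0]
      have hf : Tendsto (fun n : ℕ => α ^ (n : ℤ) * r n) atTop (𝓝 0) := by
        have h1 : Tendsto (fun n : ℕ => r n) atTop (𝓝 0) :=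
          (hr.comp_injective (i := fun n : ℕ => (n : ℤ)) Nat.cast_injective).tendsto_atTop_zero
        have h2 := (tendsto_pow_atTop_nhds_zero_of_lt_one hα0.le hα).mul h1
        simpa using h2
      refine tendsto_of_tendsto_of_tendsto_of_le_of_le tendsto_const_nhds (ofR (α ^ (-k)) hf)
        (fun _ => zero_le) ?_
      intro n
      simp only [edist_eq_enorm_sub, sub_zero]
      exact (wt_coord hN0 S₀ hα0 (p n) k).trans (mul_le_mul_right (hp0 n) _)
    · rw [tendsto_iff_edist_tendsto_0]
      have hf : Tendsto (fun n : ℕ => β ^ (-(n : ℤ)) * r (-n)) atTop (𝓝 0) := by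
        have h1 : Tendsto (fun n : ℕ => r (-n)) atTop (𝓝 0) :=
          (hr.comp_injective (i := fun n : ℕ => (-n : ℤ))
            (fun a b h => by simpa using h)).tendsto_atTop_zero
        have h2 := (tendsto_pow_atTop_nhds_zero_of_lt_one (inv_nonneg.2 hβ0.le)
          (inv_lt_one_of_one_lt₀ hβ)).mul h1
        simpa using h2
      refine tendsto_of_tendsto_of_tendsto_of_le_of_le tendsto_const_nhds (ofR (β ^ (-k)) hf)
        (fun _ => zero_le) ?_
      intro n
      simp only [edist_comm _ (y k)]
      simp only [edist_eq_enorm_sub]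
      exact (wt_coord hN1 S₁ hβ0 (y - p (-n)) k).trans (mul_le_mul_right (hp1 (-n)) _)
  have hyt : HasSum y t := by
    let φ : ℤ × ℤ ≃ ℤ × ℤ :=
      { toFun := fun q => (q.2, q.1 - q.2)
        invFun := fun q => (q.2 + q.1, q.1)
        left_inv := fun q => by ext <;> simp
        right_inv := fun q => by ext <;> simp }
    have ht' : HasSum (fun q : ℤ × ℤ => d q.2 q.1) t := by
      have := φ.hasSum_iff.2 ht
      convert this using 2 with q
      simp [φ, hX]
    exact ht'.prod_fiberwise hyk
  rw [hy.unique hyt]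
  exact hxt

theorem upstep {E F : Type*} [NormedAddCommGroup E] [NormedSpace ℝ E]
    [NormedAddCommGroup F] [NormedSpace ℝ F]
    {N₀ N₁ : BanachENorm ℝ E} (M₀ M₁ : BanachENorm ℝ F)
    (hcompF : ∀ w : F, enSum M₀.toFun M₁.toFun w = (‖w‖₊ : ℝ≥0∞))
    (S₀ : SeqStructure ℝ E N₀) (S₁ : SeqStructure ℝ E N₁)
    (T₀ : SeqStructure ℝ F M₀) (T₁ : SeqStructure ℝ F M₁)
    (ι : F →L[ℝ] E) (hι : Function.Injective ι)
    {σ₀ τ₀ γ₀ σ₁ τ₁ γ₁ α β : ℝ} (hγ₀0 : 0 < γ₀) (hγ₀ : γ₀ < 1) (hγ₁ : 1 < γ₁)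
    (h00 : σ₀ * γ₀ = α) (h01 : τ₀ * γ₀ = β) (h10 : σ₁ * γ₁ = α) (h11 : τ₁ * γ₁ = β)
    (C₀ C₁ : ℝ≥0∞) (hC₀ : C₀ ≠ ∞) (hC₁ : C₁ ≠ ∞)
    (he₀ : ∀ x : ℤ → E, max (wtSeq σ₀ S₀.toFun x) (wtSeq τ₀ S₁.toFun x) ≠ ∞ →
      ∃ y : ℤ → F, (∀ k, ι (y k) = x k) ∧
        T₀.toFun y ≤ C₀ * max (wtSeq σ₀ S₀.toFun x) (wtSeq τ₀ S₁.toFun x))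
    (he₁ : ∀ x : ℤ → E, max (wtSeq σ₁ S₀.toFun x) (wtSeq τ₁ S₁.toFun x) ≠ ∞ →
      ∃ y : ℤ → F, (∀ k, ι (y k) = x k) ∧
        T₁.toFun y ≤ C₁ * max (wtSeq σ₁ S₀.toFun x) (wtSeq τ₁ S₁.toFun x))
    (x : ℤ → E) (u : E) (hx : HasSum x u)
    (hfin : max (wtSeq α S₀.toFun x) (wtSeq β S₁.toFun x) ≠ ∞) :
    ∃ (y : ℤ → F) (v : F), HasSum y v ∧ ι v = u ∧
      max (wtSeq γ₀ T₀.toFun y) (wtSeq γ₁ T₁.toFun y) ≤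
        (C₀ + C₁) * max (wtSeq α S₀.toFun x) (wtSeq β S₁.toFun x) := by
  have hγ₁0 : 0 < γ₁ := one_pos.trans hγ₁
  have := complete_of_comp M₀ M₁ hcompF
  have hM0 := en_sum_le₀ M₀ M₁ hcompF
  have hM1 := en_sum_le₁ M₀ M₁ hcompF
  have hk₀ : ∀ k : ℤ, γ₀ ^ k ≠ 0 := fun k => (zpow_pos hγ₀0 k).ne'
  have hk₁ : ∀ k : ℤ, γ₁ ^ k ≠ 0 := fun k => (zpow_pos hγ₁0 k).ne'
  have q0 := he₀ (fun k => γ₀ ^ k • x k)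
  have q1 := he₁ (fun k => γ₁ ^ k • x k)
  rw [wt_wt, wt_wt, h00, h01] at q0
  rw [wt_wt, wt_wt, h10, h11] at q1
  obtain ⟨y0, hy0, b0⟩ := q0 hfin
  obtain ⟨y1, hy1, b1⟩ := q1 hfin
  set m := max (wtSeq α S₀.toFun x) (wtSeq β S₁.toFun x) with hm
  set y : ℤ → F := fun k => (γ₀ ^ k)⁻¹ • y0 k with hy
  have hιy : ∀ k, ι (y k) = x k := by
    intro k
    simp [hy, hy0, smul_smul, hk₀]
  have e0 : wtSeq γ₀ T₀.toFun y = T₀.toFun y0 := by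
    unfold wtSeq; congr 1; funext k
    simp [hy, smul_smul, hk₀]
  have e1 : wtSeq γ₁ T₁.toFun y = T₁.toFun y1 := by
    unfold wtSeq; congr 1; funext k
    apply hι
    rw [map_smul, hιy, hy1]
  have f0 : wtSeq γ₀ T₀.toFun y ≤ (C₀ + C₁) * m := by
    rw [e0]; refine b0.trans ?_; gcongr; exact le_self_add
  have f1 : wtSeq γ₁ T₁.toFun y ≤ (C₀ + C₁) * m := by
    rw [e1]; refine b1.trans ?_; gcongr; exact le_add_self
  have hB : (C₀ + C₁) * m ≠ ∞ := ENNReal.mul_ne_top (by finiteness) hfin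
  have hbd : ∀ k, ‖y k‖ ≤ ((C₀ + C₁) * m).toReal * min (γ₀ ^ (-k)) (γ₁ ^ (-k)) := by
    intro k
    have b0 := (wt_coord hM0 T₀ hγ₀0 y k).trans (mul_le_mul_right f0 _)
    have b1 := (wt_coord hM1 T₁ hγ₁0 y k).trans (mul_le_mul_right f1 _)
    have cv : ∀ t : ℝ, 0 < t → ‖y k‖ₑ ≤ ENNReal.ofReal t * ((C₀ + C₁) * m) →
        ‖y k‖ ≤ ((C₀ + C₁) * m).toReal * t := by
      intro t ht h
      have := ENNReal.toReal_mono (ENNReal.mul_ne_top ENNReal.ofReal_ne_top hB) h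
      rw [toReal_enorm, ENNReal.toReal_mul, ENNReal.toReal_ofReal ht.le] at this
      linarith
    rcases min_choice (γ₀ ^ (-k)) (γ₁ ^ (-k)) with h | h <;> rw [h]
    · exact cv _ (zpow_pos hγ₀0 _) b0
    · exact cv _ (zpow_pos hγ₁0 _) b1
  obtain ⟨v, hv⟩ := Summable.of_norm_bounded
    ((summable_min hγ₀0 hγ₀ hγ₁).mul_left _) hbd
  refine ⟨y, v, hv, ?_, max_le f0 f1⟩
  have := ι.hasSum hv
  simp only [hιy] at this
  exact this.unique hx

end Reit

/-- reiteration. Let `0 ≤ θ₀ < θ₁ ≤ 1`, `θ ∈ (0,1)`,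
`ω = (1-θ)θ₀ + θθ₁` and `b = a^{θ₁-θ₀}` with `a ∈ (1,∞)`.  If
`𝔖₀(a^{-θ_j}) ∩ 𝔖₁(a^{1-θ_j}) ↪ 𝔗_j ↪ 𝔖₀(a^{-θ_j}) + 𝔖₁(a^{1-θ_j})` continuously for
`j = 0,1` (with `ι : Y₀+Y₁ → X₀+X₁` the inclusion of the sum spaces), then
`(𝒳₀,𝒳₁)_{ω;a} = (𝒴₀,𝒴₁)_{θ;b}` with equivalent norms. -/
theorem statement18 {E : Type u} {F : Type v}
    [NormedAddCommGroup E] [NormedSpace ℝ E] [NormedAddCommGroup F] [NormedSpace ℝ F]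
    (N₀ N₁ : BanachENorm ℝ E)
    (hcompE : ∀ v : E, enSum N₀.toFun N₁.toFun v = (‖v‖₊ : ℝ≥0∞))
    (M₀ M₁ : BanachENorm ℝ F)
    (hcompF : ∀ w : F, enSum M₀.toFun M₁.toFun w = (‖w‖₊ : ℝ≥0∞))
    (S₀ : SeqStructure ℝ E N₀) (S₁ : SeqStructure ℝ E N₁)
    (T₀ : SeqStructure ℝ F M₀) (T₁ : SeqStructure ℝ F M₁)
    (ι : F →L[ℝ] E) (hι : Function.Injective ι)
    (θ₀ θ₁ θ ω a b : ℝ)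
    (hθ₀ : 0 ≤ θ₀) (hθ₀₁ : θ₀ < θ₁) (hθ₁ : θ₁ ≤ 1)
    (hθ : θ ∈ Set.Ioo (0 : ℝ) 1)
    (hω : ω = (1 - θ) * θ₀ + θ * θ₁)
    (ha : 1 < a) (hb : b = a ^ (θ₁ - θ₀))
    (hemb₀ : ∃ C : ℝ≥0∞, C ≠ ∞ ∧ ∀ x : ℤ → E,
      max (wtSeq (a ^ (-θ₀)) S₀.toFun x) (wtSeq (a ^ (1 - θ₀)) S₁.toFun x) ≠ ∞ →
      ∃ y : ℤ → F, (∀ k, ι (y k) = x k) ∧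
        T₀.toFun y ≤
          C * max (wtSeq (a ^ (-θ₀)) S₀.toFun x) (wtSeq (a ^ (1 - θ₀)) S₁.toFun x))
    (hemb₀' : ∃ C : ℝ≥0∞, C ≠ ∞ ∧ ∀ y : ℤ → F,
      enSum (wtSeq (a ^ (-θ₀)) S₀.toFun) (wtSeq (a ^ (1 - θ₀)) S₁.toFun)
          (fun k => ι (y k)) ≤ C * T₀.toFun y)
    (hemb₁ : ∃ C : ℝ≥0∞, C ≠ ∞ ∧ ∀ x : ℤ → E,
      max (wtSeq (a ^ (-θ₁)) S₀.toFun x) (wtSeq (a ^ (1 - θ₁)) S₁.toFun x) ≠ ∞ →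
      ∃ y : ℤ → F, (∀ k, ι (y k) = x k) ∧
        T₁.toFun y ≤
          C * max (wtSeq (a ^ (-θ₁)) S₀.toFun x) (wtSeq (a ^ (1 - θ₁)) S₁.toFun x))
    (hemb₁' : ∃ C : ℝ≥0∞, C ≠ ∞ ∧ ∀ y : ℤ → F,
      enSum (wtSeq (a ^ (-θ₁)) S₀.toFun) (wtSeq (a ^ (1 - θ₁)) S₁.toFun)
          (fun k => ι (y k)) ≤ C * T₁.toFun y) :
    ∃ C : ℝ≥0∞, C ≠ ∞ ∧
      (∀ v : F,
        (interpENormB a S₀.toFun S₁.toFun ω (ι v) ≤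
          C * interpENormB b T₀.toFun T₁.toFun θ v) ∧
        (interpENormB b T₀.toFun T₁.toFun θ v ≤
          C * interpENormB a S₀.toFun S₁.toFun ω (ι v))) ∧
      (∀ u : E, interpENormB a S₀.toFun S₁.toFun ω u ≠ ∞ → ∃ v : F, ι v = u) := by
  obtain ⟨A₀, hA₀, hA₀'⟩ := hemb₀
  obtain ⟨A₁, hA₁, hA₁'⟩ := hemb₁
  obtain ⟨B₀, hB₀, hB₀'⟩ := hemb₀'
  obtain ⟨B₁, hB₁, hB₁'⟩ := hemb₁'
  have ha0 : 0 < a := one_pos.trans ha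
  have hb1 : 1 < b := by rw [hb]; exact Real.one_lt_rpow ha (sub_pos.2 hθ₀₁)
  have hb0 : 0 < b := one_pos.trans hb1
  obtain ⟨hθl, hθr⟩ := hθ
  have hω0 : 0 < ω := by
    rw [hω]
    have := mul_pos hθl (lt_of_le_of_lt hθ₀ hθ₀₁)
    have := mul_nonneg (sub_pos.2 hθr).le hθ₀
    linarith
  have hω1 : ω < 1 := by
    have := mul_pos (sub_pos.2 hθr) (sub_pos.2 hθ₀₁)
    rw [hω]; nlinarith
  have hbr : ∀ t : ℝ, b ^ t = a ^ ((θ₁ - θ₀) * t) := fun t => by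
    rw [hb, ← Real.rpow_mul ha0.le]
  have h00 : a ^ (-θ₀) * b ^ (-θ) = a ^ (-ω) := by
    rw [hbr, ← Real.rpow_add ha0]; congr 1; rw [hω]; ring
  have h01 : a ^ (1 - θ₀) * b ^ (-θ) = a ^ (1 - ω) := by
    rw [hbr, ← Real.rpow_add ha0]; congr 1; rw [hω]; ring
  have h10 : a ^ (-θ₁) * b ^ (1 - θ) = a ^ (-ω) := by
    rw [hbr, ← Real.rpow_add ha0]; congr 1; rw [hω]; ring
  have h11 : a ^ (1 - θ₁) * b ^ (1 - θ) = a ^ (1 - ω) := by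
    rw [hbr, ← Real.rpow_add ha0]; congr 1; rw [hω]; ring
  have hγ₀ : b ^ (-θ) < 1 := Real.rpow_lt_one_of_one_lt_of_neg hb1 (neg_neg_of_pos hθl)
  have hγ₁ : 1 < b ^ (1 - θ) := Real.one_lt_rpow hb1 (sub_pos.2 hθr)
  have hγ₀0 : 0 < b ^ (-θ) := Real.rpow_pos_of_pos hb0 _
  have hγ₁0 : 0 < b ^ (1 - θ) := Real.rpow_pos_of_pos hb0 _
  have hα0 : 0 < a ^ (-ω) := Real.rpow_pos_of_pos ha0 _
  have hα : a ^ (-ω) < 1 := Real.rpow_lt_one_of_one_lt_of_neg ha (neg_neg_of_pos hω0)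
  have hβ : 1 < a ^ (1 - ω) := Real.one_lt_rpow ha (sub_pos.2 hω1)
  have hσ₀ : 0 < a ^ (-θ₀) := Real.rpow_pos_of_pos ha0 _
  have hτ₀ : 0 < a ^ (1 - θ₀) := Real.rpow_pos_of_pos ha0 _
  have hσ₁ : 0 < a ^ (-θ₁) := Real.rpow_pos_of_pos ha0 _
  have hτ₁ : 0 < a ^ (1 - θ₁) := Real.rpow_pos_of_pos ha0 _
  have up := fun x u hx hf => Reit.upstep M₀ M₁ hcompF S₀ S₁ T₀ T₁ ι hι hγ₀0 hγ₀ hγ₁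
    h00 h01 h10 h11 A₀ A₁ hA₀ hA₁ hA₀' hA₁' x u hx hf
  generalize a ^ (-θ₀) = σ₀ at *
  generalize a ^ (1 - θ₀) = τ₀ at *
  generalize a ^ (-θ₁) = σ₁ at *
  generalize a ^ (1 - θ₁) = τ₁ at *
  unfold interpENormB
  generalize b ^ (-θ) = γ₀ at *
  generalize b ^ (1 - θ) = γ₁ at *
  generalize a ^ (-ω) = α at *
  generalize a ^ (1 - ω) = β at *
  set r : ℤ → ℝ := fun n => min (γ₀ ^ (-n)) (γ₁ ^ (-n)) with hr
  have hrs : Summable r := Reit.summable_min hγ₀0 hγ₀ hγ₁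
  have hr0 : ∀ n, 0 ≤ r n := fun n => le_min (zpow_pos hγ₀0 _).le (zpow_pos hγ₁0 _).le
  set K : ℝ≥0∞ := ∑' n, ENNReal.ofReal (r n + β * r (n + 1)) with hK
  have hKt : K ≠ ∞ := by
    refine Summable.tsum_ofReal_ne_top (hrs.add (Summable.mul_left _ ?_))
    exact hrs.comp_injective (i := fun n : ℤ => n + 1) (add_left_injective 1)
  have zp : ∀ {σ γ δ : ℝ} (n : ℤ), 0 < γ → σ * γ = δ → σ ^ n = δ ^ n * γ ^ (-n) := by
    intro σ γ δ n hγ h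
    rw [← h, mul_zpow, zpow_neg, mul_assoc, mul_inv_cancel₀ (zpow_pos hγ n).ne', mul_one]
  -- the downward bound for one representation
  have down : ∀ (y : ℤ → F) (v : F), HasSum y v → ∀ D : ℝ≥0∞, D ≠ ∞ →
      (B₀ + B₁) * max (wtSeq γ₀ T₀.toFun y) (wtSeq γ₁ T₁.toFun y) < D →
      (⨅ (x : ℤ → E) (_ : HasSum x (ι v)), max (wtSeq α S₀.toFun x) (wtSeq β S₁.toFun x))
        ≤ (K + 1) * D := by
    intro y v hy D hDt hD
    have hD0 : B₀ * wtSeq γ₀ T₀.toFun y < D :=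
      lt_of_le_of_lt (mul_le_mul' le_self_add (le_max_left _ _)) hD
    have hD1 : B₁ * wtSeq γ₁ T₁.toFun y < D :=
      lt_of_le_of_lt (mul_le_mul' le_add_self (le_max_right _ _)) hD
    have hex : ∀ n : ℤ, ∃ p : ℤ → E,
        wtSeq α S₀.toFun p ≤ ENNReal.ofReal (α ^ n * r n) * D ∧
        wtSeq β S₁.toFun ((fun k => ι (y k)) - p) ≤ ENNReal.ofReal (β ^ n * r n) * D := by
      intro n
      rcases min_choice (γ₀ ^ (-n)) (γ₁ ^ (-n)) with h | h
      · have := Reit.kstep S₀ S₁ T₀ ι hσ₀ hτ₀ hγ₀0 B₀ hB₀' y D hD0 n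
        rw [zp n hγ₀0 h00, zp n hγ₀0 h01, h00, h01] at this
        simpa only [hr, h] using this
      · have := Reit.kstep S₀ S₁ T₁ ι hσ₁ hτ₁ hγ₁0 B₁ hB₁' y D hD1 n
        rw [zp n hγ₁0 h10, zp n hγ₁0 h11, h10, h11] at this
        simpa only [hr, h] using this
    choose p hp0 hp1 using hex
    obtain ⟨x, hx, c0, c1⟩ := Reit.mainstep N₀ N₁ hcompE S₀ S₁ hα0 hα hβ r hr0 hrs D hDt
      (fun k => ι (y k)) (ι v) (ι.hasSum hy) p hp0 hp1
    refine (iInf₂_le x hx).trans ((max_le c0 c1).trans ?_)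
    gcongr
    exact le_self_add
  have hC0 : ((K + 1) * (B₀ + B₁) + (A₀ + A₁) + 1 : ℝ≥0∞) ≠ 0 := by simp
  have hCt : ((K + 1) * (B₀ + B₁) + (A₀ + A₁) + 1 : ℝ≥0∞) ≠ ∞ := by finiteness
  refine ⟨(K + 1) * (B₀ + B₁) + (A₀ + A₁) + 1, hCt, fun v => ⟨?_, ?_⟩, ?_⟩
  · rw [← ENNReal.div_le_iff' hC0 hCt]
    refine le_iInf₂ fun y hy => ?_
    rw [ENNReal.div_le_iff' hC0 hCt]
    by_cases htop : max (wtSeq γ₀ T₀.toFun y) (wtSeq γ₁ T₁.toFun y) = ∞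
    · rw [htop, ENNReal.mul_top hC0]; exact le_top
    · have hK0 : K + 1 ≠ 0 := by simp
      have hKt' : K + 1 ≠ ∞ := by finiteness
      have key : (⨅ (x : ℤ → E) (_ : HasSum x (ι v)),
          max (wtSeq α S₀.toFun x) (wtSeq β S₁.toFun x)) / (K + 1) ≤
          (B₀ + B₁) * max (wtSeq γ₀ T₀.toFun y) (wtSeq γ₁ T₁.toFun y) := by
        refine le_of_forall_gt_imp_ge_of_dense fun D hD => ?_
        by_cases hDt : D = ∞
        · rw [hDt]; exact le_top
        · rw [ENNReal.div_le_iff' hK0 hKt']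
          exact down y v hy D hDt hD
      rw [ENNReal.div_le_iff' hK0 hKt', ← mul_assoc] at key
      refine key.trans ?_
      gcongr
      rw [add_assoc]; exact le_self_add
  · rw [← ENNReal.div_le_iff' hC0 hCt]
    refine le_iInf₂ fun x hx => ?_
    rw [ENNReal.div_le_iff' hC0 hCt]
    by_cases htop : max (wtSeq α S₀.toFun x) (wtSeq β S₁.toFun x) = ∞
    · rw [htop, ENNReal.mul_top hC0]; exact le_top
    · obtain ⟨y, v', hy, hv, hle⟩ := up x (ι v) hx htop
      have : v' = v := hι hv
      subst this
      refine (iInf₂_le y hy).trans (hle.trans ?_)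
      refine mul_le_mul' ?_ le_rfl
      exact le_add_self.trans le_self_add
  · intro u hu
    obtain ⟨x, hx⟩ := iInf_lt_iff.1 (lt_top_iff_ne_top.2 hu)
    obtain ⟨hs, hx⟩ := iInf_lt_iff.1 hx
    obtain ⟨y, v, hy, hv, -⟩ := up x u hs hx.ne
    exact ⟨v, hv⟩
end
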